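/- Let G=(V,E) be a 2-rigid graph with |V| ≥ 4 in which every ℛ₂-block induces a complete subgraph of G. Call a vertex y ∈ V reducible if either y belongs to exactly one ℛ₂-block of G and is incident with at most one ℛ₂-bridge of G, or y belongs to no ℛ₂-block of G and is incident with at most three ℛ₂-bridges of G. Then G has at least three reducible vertices. -/

import Mathlib

open scoped BigOperators

noncomputable section

namespace Rigidity

variable {V : Type*}

/-- Euclidean distance between two points of `ℝ^d` (given as coordinate functions). -/
def eDist {d : ℕ} (x y : Fin d → ℝ) : ℝ := Real.sqrt (∑ i, (x i - y i) ^ 2)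

/-- Two frameworks `(G,p)` and `(G,q)` are equivalent if corresponding edge lengths agree. -/
def Equivalent {d : ℕ} (G : SimpleGraph V) (p q : V → Fin d → ℝ) : Prop :=
  ∀ u v : V, G.Adj u v → eDist (p u) (p v) = eDist (q u) (q v)

/-- Two placements are congruent if all pairwise distances agree. -/
def Congruent {d : ℕ} (p q : V → Fin d → ℝ) : Prop :=
  ∀ u v : V, eDist (p u) (p v) = eDist (q u) (q v)

/-- A placement is generic if the multiset of its coordinates is algebraically
independent over `ℚ`. -/
def Generic {d : ℕ} (p : V → Fin d → ℝ) : Prop :=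
  AlgebraicIndependent ℚ (fun vi : V × Fin d => p vi.1 vi.2)

/-- `{u,v}` is globally linked in the framework `(G,p)`. -/
def GloballyLinkedIn {d : ℕ} (G : SimpleGraph V) (p : V → Fin d → ℝ) (u v : V) : Prop :=
  ∀ q : V → Fin d → ℝ, Equivalent G p q → eDist (q u) (q v) = eDist (p u) (p v)

/-- `{u,v}` is globally `d`-linked in `G`. -/
def GloballyLinked (d : ℕ) (G : SimpleGraph V) (u v : V) : Prop :=
  ∀ p : V → Fin d → ℝ, Generic p → GloballyLinkedIn G p u v

/-- The framework `(G,p)` is rigid. -/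
def RigidFramework {d : ℕ} (G : SimpleGraph V) (p : V → Fin d → ℝ) : Prop :=
  ∃ ε > (0:ℝ), ∀ q : V → Fin d → ℝ, Equivalent G p q →
    (∀ v, eDist (p v) (q v) < ε) → Congruent p q

/-- `G` is `d`-rigid: every generic framework of `G` in `ℝ^d` is rigid. -/
def IsRigidGraph (d : ℕ) (G : SimpleGraph V) : Prop :=
  ∀ p : V → Fin d → ℝ, Generic p → RigidFramework G p

/-- The framework `(G,p)` is globally rigid. -/
def GloballyRigidFramework {d : ℕ} (G : SimpleGraph V) (p : V → Fin d → ℝ) : Prop :=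
  ∀ q : V → Fin d → ℝ, Equivalent G p q → Congruent p q

/-- The row of the rigidity matrix corresponding to the (ordered) edge `(u,v)`. -/
def edgeVec [DecidableEq V] {d : ℕ} (p : V → Fin d → ℝ) (u v : V) : V × Fin d → ℝ :=
  fun wi => if wi.1 = u then p u wi.2 - p v wi.2
            else if wi.1 = v then p v wi.2 - p u wi.2 else 0

/-- The rank of the set of rows of the rigidity matrix of `(·,p)` indexed by `F`. -/
def rankAt [DecidableEq V] (d : ℕ) (p : V → Fin d → ℝ) (F : Set (Sym2 V)) : ℕ :=
  Module.finrank ℝ (Submodule.span ℝ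
    {x : V × Fin d → ℝ | ∃ u v : V, s(u, v) ∈ F ∧ x = edgeVec p u v})

/-- `r_d(F)`: the rank of the set of rows indexed by `F` of the rigidity matrix of a
generic framework, equivalently the maximum of this rank over all placements. -/
def rd [DecidableEq V] (d : ℕ) (F : Set (Sym2 V)) : ℕ :=
  sSup {n : ℕ | ∃ p : V → Fin d → ℝ, n = rankAt d p F}

/-- An edge set is `ℛ_d`-independent if its rank equals its cardinality. -/
def RdIndep [DecidableEq V] (d : ℕ) (F : Set (Sym2 V)) : Prop := rd d F = F.ncard

/-- An `ℛ_d`-circuit: not independent, but every proper subset is independent. -/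
def RdCircuit [DecidableEq V] (d : ℕ) (C : Set (Sym2 V)) : Prop :=
  ¬ RdIndep d C ∧ ∀ C' : Set (Sym2 V), C' ⊂ C → RdIndep d C'

/-- An `ℛ_d`-circuit of the graph `G`. -/
def RdCircuitOf [DecidableEq V] (d : ℕ) (G : SimpleGraph V) (C : Set (Sym2 V)) : Prop :=
  C ⊆ G.edgeSet ∧ RdCircuit d C

/-- `F` is (the edge set of) an `ℛ_d`-component of `G`: an equivalence class of the
relation "`e = f` or some `ℛ_d`-circuit of `G` contains both `e` and `f`". -/
def IsRdComponent [DecidableEq V] (d : ℕ) (G : SimpleGraph V) (F : Set (Sym2 V)) : Prop :=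
  ∃ e ∈ G.edgeSet, F = {f | f ∈ G.edgeSet ∧
    (e = f ∨ ∃ C, RdCircuitOf d G C ∧ e ∈ C ∧ f ∈ C)}

/-- The set of vertices covered by an edge set. -/
def vertexSpan (F : Set (Sym2 V)) : Set V := {v | ∃ e ∈ F, v ∈ e}

/-- A nonempty edge set is `ℛ_d`-connected if any two of its edges lie on a common
`ℛ_d`-circuit contained in it (or are equal). -/
def RdConnectedSet [DecidableEq V] (d : ℕ) (F : Set (Sym2 V)) : Prop :=
  F.Nonempty ∧ ∀ e ∈ F, ∀ f ∈ F, e = f ∨ ∃ C, C ⊆ F ∧ RdCircuit d C ∧ e ∈ C ∧ f ∈ C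

/-- A graph (with at least one edge) is `ℛ_d`-connected. -/
def RdConnected [DecidableEq V] (d : ℕ) (H : SimpleGraph V) : Prop :=
  RdConnectedSet d H.edgeSet

/-- `e` is an `ℛ_d`-bridge of `G`: `r_d(E ∖ {e}) = r_d(E) − 1`. -/
def IsRdBridge [DecidableEq V] (d : ℕ) (G : SimpleGraph V) (e : Sym2 V) : Prop :=
  e ∈ G.edgeSet ∧ rd d (G.edgeSet \ {e}) + 1 = rd d G.edgeSet

/-- `G + uv`. -/
def addEdge (G : SimpleGraph V) (u v : V) : SimpleGraph V :=
  G ⊔ SimpleGraph.fromEdgeSet {s(u, v)}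

/-- `{u,v}` is `d`-linked in `G` if `r_d(G+uv) = r_d(G)`. -/
def IsLinked [DecidableEq V] (d : ℕ) (G : SimpleGraph V) (u v : V) : Prop :=
  rd d (addEdge G u v).edgeSet = rd d G.edgeSet

/-- There exist `k` pairwise internally vertex-disjoint `u`–`v` paths in `H`
(i.e. `κ_H(u,v) ≥ k`). -/
def InternallyDisjointPaths (H : SimpleGraph V) (u v : V) (k : ℕ) : Prop :=
  ∃ P : Fin k → H.Walk u v, (∀ i, (P i).IsPath) ∧
    ∀ i j, i ≠ j → ∀ w, w ∈ (P i).support → w ∈ (P j).support → w = u ∨ w = v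

/-- An unordered pair forming a 2-separator: two distinct vertices whose deletion
disconnects the graph. -/
def TwoSepPair (H : SimpleGraph V) (e : Sym2 V) : Prop :=
  ¬ e.IsDiag ∧ ¬ (H.induce {v | v ∉ e}).Connected

/-- The augmented graph `Ĥ`: add an edge for every 2-separator. -/
def aug (H : SimpleGraph V) : SimpleGraph V :=
  H ⊔ SimpleGraph.fromEdgeSet {e | TwoSepPair H e}

/-- A subgraph is 3-connected: at least 4 vertices, and deleting fewer than 3
vertices leaves it connected. -/
def IsThreeConnectedSubgraph {G : SimpleGraph V} (J : G.Subgraph) : Prop :=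
  4 ≤ J.verts.ncard ∧ ∀ S : Set V, S.ncard < 3 → (J.deleteVerts S).coe.Connected

/-- A 3-block of `H`: a maximal 3-connected subgraph of the augmented graph `Ĥ`. -/
def IsThreeBlock (H : SimpleGraph V) (J : (aug H).Subgraph) : Prop :=
  IsThreeConnectedSubgraph J ∧
    ∀ J' : (aug H).Subgraph, IsThreeConnectedSubgraph J' → J ≤ J' → J = J'

/-- `h_H(e)`: the number of 3-blocks of `H` containing both vertices of `e`. -/
def numBlocksOn (H : SimpleGraph V) (e : Sym2 V) : ℕ :=
  {J : (aug H).Subgraph | IsThreeBlock H J ∧ ∀ v ∈ e, v ∈ J.verts}.ncard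

open Classical in
/-- `k(H) = Σ (h_H(ab) − 1)` over all 2-separators `{a,b}` of `H`. -/
def kGraph [Fintype V] [DecidableEq V] (H : SimpleGraph V) : ℕ :=
  ∑ e : Sym2 V, if TwoSepPair H e then numBlocksOn H e - 1 else 0

/-- The graph of an `ℛ₂`-component, on its own vertex set. -/
def componentGraph [DecidableEq V] (F : Set (Sym2 V)) :
    SimpleGraph (vertexSpan F) :=
  (SimpleGraph.fromEdgeSet F).induce (vertexSpan F)

/-- `X` is the vertex set of an `ℛ_d`-block of `G`: a 3-block of a non-trivial
`ℛ_d`-component of `G`. -/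
def IsRdBlockVerts [DecidableEq V] (d : ℕ) (G : SimpleGraph V) (X : Set V) : Prop :=
  ∃ F : Set (Sym2 V), IsRdComponent d G F ∧ 2 ≤ F.ncard ∧
    ∃ J : (aug (componentGraph F)).Subgraph,
      IsThreeBlock (componentGraph F) J ∧ X = Subtype.val '' J.verts

/-- The globally linked closure of `G` in `ℝ^d`. -/
def glc (d : ℕ) (G : SimpleGraph V) : SimpleGraph V :=
  G ⊔ SimpleGraph.fromEdgeSet {e | ∃ u v : V, e = s(u, v) ∧ GloballyLinked d G u v}

/-- A globally `d`-linked cluster: the vertex set of a maximal complete subgraph of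
`glc_d(G)`. -/
def IsCluster (d : ℕ) (G : SimpleGraph V) (X : Set V) : Prop :=
  (∀ a ∈ X, ∀ b ∈ X, a ≠ b → (glc d G).Adj a b) ∧
    ∀ Y : Set V, X ⊆ Y → (∀ a ∈ Y, ∀ b ∈ Y, a ≠ b → (glc d G).Adj a b) → Y = X

/-- Equilibrium stress of a framework, encoded as a symmetric function vanishing on
non-edges. -/
def IsEqStress [Fintype V] {d : ℕ} (G : SimpleGraph V) (p : V → Fin d → ℝ)
    (ω : V → V → ℝ) : Prop :=
  (∀ u v, ω u v = ω v u) ∧ (∀ u v, ¬ G.Adj u v → ω u v = 0) ∧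
    ∀ u, ∑ v, ω u v • (p u - p v) = 0

/-- `{u,v}` is `d`-stress-linked in `G`. -/
def StressLinked [Fintype V] (d : ℕ) (G : SimpleGraph V) (u v : V) : Prop :=
  ∀ p : V → Fin d → ℝ, Generic p → ∀ q : V → Fin d → ℝ,
    (∀ ω, IsEqStress G p ω → IsEqStress G q ω) →
    ∀ ω, IsEqStress (addEdge G u v) p ω → IsEqStress (addEdge G u v) q ω

/-- Equivalence of complex frameworks. -/
def CEquivalent {d : ℕ} (G : SimpleGraph V) (p q : V → Fin d → ℂ) : Prop :=
  ∀ u v : V, G.Adj u v →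
    ∑ i, (p u i - p v i) ^ 2 = ∑ i, (q u i - q v i) ^ 2

/-- Generic complex placement. -/
def CGeneric {d : ℕ} (p : V → Fin d → ℂ) : Prop :=
  AlgebraicIndependent ℚ (fun vi : V × Fin d => p vi.1 vi.2)

/-- `{u,v}` is globally linked in `G` in `ℂ^d`. -/
def CGloballyLinked (d : ℕ) (G : SimpleGraph V) (u v : V) : Prop :=
  ∀ p : V → Fin d → ℂ, CGeneric p → ∀ q : V → Fin d → ℂ, CEquivalent G p q →
    ∑ i, (q u i - q v i) ^ 2 = ∑ i, (p u i - p v i) ^ 2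

/-- A flexing of the framework `(G,q)`. -/
def IsFlexing {d : ℕ} (G : SimpleGraph V) (q : V → Fin d → ℝ)
    (φ : Set.Icc (0:ℝ) 1 → V → Fin d → ℝ) : Prop :=
  Continuous φ ∧ φ ⟨0, Set.left_mem_Icc.mpr zero_le_one⟩ = q ∧
    (∀ t, Equivalent G q (φ t)) ∧
    ∀ t : Set.Icc (0:ℝ) 1, 0 < (t : ℝ) → ¬ Congruent q (φ t)

/-- A finite loopless multigraph on vertex type `V` with edge type `E`. -/
structure Multigraph (V : Type*) (E : Type*) where
  ends : E → Sym2 V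
  loopless : ∀ e, ¬ (ends e).IsDiag

/-- The data `(B, bar)` exhibits `G` as a body-bar graph induced by `H`. -/
def IsBodyBar {V E W : Type*} (H : Multigraph V E) (G : SimpleGraph W)
    (B : V → Set W) (bar : E → W × W) : Prop :=
  (∀ w : W, ∃! v : V, w ∈ B v) ∧
  (∀ v : V, (B v).ncard = {e : E | v ∈ H.ends e}.ncard) ∧
  (∀ e : E, ∃ w z : V, H.ends e = s(w, z) ∧ (bar e).1 ∈ B w ∧ (bar e).2 ∈ B z) ∧
  (∀ e : E, (bar e).1 ≠ (bar e).2) ∧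
  (∀ e e' : E, e ≠ e' →
    ({(bar e).1, (bar e).2} ∩ {(bar e').1, (bar e').2} : Set W) = ∅) ∧
  (∀ a b : W, G.Adj a b ↔ a ≠ b ∧
    ((∃ v : V, a ∈ B v ∧ b ∈ B v) ∨ ∃ e : E, s(a, b) = s((bar e).1, (bar e).2)))

/-- `P` is a partition of the set `X`. -/
def IsPartitionOf {V : Type*} (X : Set V) (P : Set (Set V)) : Prop :=
  (∀ p ∈ P, p.Nonempty ∧ p ⊆ X) ∧ ∀ v ∈ X, ∃! p, p ∈ P ∧ v ∈ p

/-- The subgraph `(X,F)` of the multigraph `H` is `k`-tree-connected. -/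
def SubTreeConnected {V E : Type*} (k : ℕ) (H : Multigraph V E)
    (X : Set V) (F : Set E) : Prop :=
  X.Nonempty ∧ (∀ e ∈ F, ∀ v ∈ H.ends e, v ∈ X) ∧
    ∀ P : Set (Set V), IsPartitionOf X P →
      k * (P.ncard - 1) ≤ {e | e ∈ F ∧ ¬ ∃ p ∈ P, ∀ v ∈ H.ends e, v ∈ p}.ncard

/-- `(X,F)` is a `k`-superbrick of `H`: a maximal `k`-tree-connected subgraph. -/
def IsSuperbrick {V E : Type*} (k : ℕ) (H : Multigraph V E)
    (X : Set V) (F : Set E) : Prop :=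
  SubTreeConnected k H X F ∧
    ∀ X' F', SubTreeConnected k H X' F' → X ⊆ X' → F ⊆ F' → X = X' ∧ F = F'

/-- A vertex is reducible: it lies in exactly one `ℛ₂`-block and on at most one
`ℛ₂`-bridge, or lies in no `ℛ₂`-block and on at most three `ℛ₂`-bridges. -/
def Reducible {V : Type*} [DecidableEq V] (G : SimpleGraph V) (y : V) : Prop :=
  ({X : Set V | IsRdBlockVerts 2 G X ∧ y ∈ X}.ncard = 1 ∧
      {e : Sym2 V | IsRdBridge 2 G e ∧ y ∈ e}.ncard ≤ 1) ∨
  ({X : Set V | IsRdBlockVerts 2 G X ∧ y ∈ X} = ∅ ∧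
      {e : Sym2 V | IsRdBridge 2 G e ∧ y ∈ e}.ncard ≤ 3)

section LinearDependence

variable {α M : Type*} [AddCommGroup M] [Module ℝ M]

/-- A minimal linearly dependent index set of a family of vectors. -/
def DepCircuit (v : α → M) (C : Set α) : Prop :=
  ¬ LinearIndepOn ℝ v C ∧ ∀ C' : Set α, C' ⊂ C → LinearIndepOn ℝ v C'

theorem DepCircuit.eq_of_subset {v : α → M} {C D : Set α} (hC : DepCircuit v C)
    (hD : DepCircuit v D) (h : C ⊆ D) : C = D := by
  by_contra hne
  exact hC.1 (hD.2 C (h.ssubset_of_ne hne))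

variable [Fintype α]

theorem linearIndepOn_iff_forall_sum (v : α → M) (S : Set α) :
    LinearIndepOn ℝ v S ↔ ∀ f : α → ℝ, (∀ i, i ∉ S → f i = 0) →
      ∑ i, f i • v i = 0 → ∀ i, f i = 0 := by
  classical
  rw [linearIndepOn_iff'']
  constructor
  · intro h f hf hs i
    by_cases hi : i ∈ S
    · have := h (Finset.univ.filter (· ∈ S)) f (by intro j; simp) (by simpa using hf)
        (by
          rw [← hs]
          refine Finset.sum_subset (Finset.subset_univ _) ?_
          intro j _ hj
          rw [hf j (by simpa using hj), zero_smul])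
      exact this i (by simpa using hi)
    · exact hf i hi
  · intro h s f hs hf hsum i _
    refine h f (fun j hj => hf j fun hj' => hj (hs hj')) ?_ i
    rw [← hsum]
    symm
    refine Finset.sum_subset (Finset.subset_univ _) ?_
    intro j _ hj
    rw [hf j hj, zero_smul]

theorem DepCircuit.exists_dependency {v : α → M} {C : Set α} (hC : DepCircuit v C) :
    ∃ f : α → ℝ, (∀ i, f i ≠ 0 ↔ i ∈ C) ∧ ∑ i, f i • v i = 0 := by
  have h := hC.1
  rw [linearIndepOn_iff_forall_sum] at h
  push Not at h
  obtain ⟨f, hf, hs, j, hj⟩ := h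
  refine ⟨f, fun i => ⟨fun hi => by_contra fun hn => hi (hf i hn), fun hi h0 => hj ?_⟩, hs⟩
  have := (linearIndepOn_iff_forall_sum v _).1 (hC.2 (C \ {i}) ?_) f ?_ hs
  · exact this j
  · exact Set.sdiff_singleton_ssubset.2 hi
  · intro k hk
    by_cases hki : k = i
    · rw [hki, h0]
    · exact hf k fun hkC => hk ⟨hkC, hki⟩

theorem exists_depCircuit_of_dependency {v : α → M} (f : α → ℝ)
    (hf : ∑ i, f i • v i = 0) {e : α} (he : f e ≠ 0) :
    ∃ C, DepCircuit v C ∧ e ∈ C ∧ ∀ i ∈ C, f i ≠ 0 := by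
  induction h : {i | f i ≠ 0}.ncard using Nat.strong_induction_on generalizing f with
  | _ n ih =>
    by_cases hC : DepCircuit v {i | f i ≠ 0}
    · exact ⟨_, hC, he, fun i hi => hi⟩
    · have hdep : ¬ LinearIndepOn ℝ v {i | f i ≠ 0} := by
        rw [linearIndepOn_iff_forall_sum]
        intro h
        exact he (h f (fun i hi => by simpa using hi) hf e)
      have : ∃ g : α → ℝ, (∑ i, g i • v i = 0) ∧ g e ≠ 0 ∧
          {i | g i ≠ 0} ⊂ {i | f i ≠ 0} := by
        by_contra hcon
        push Not at hcon
        apply hC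
        refine ⟨hdep, fun C' hC' => ?_⟩
        rw [linearIndepOn_iff_forall_sum]
        intro g hg hgs j
        by_contra hj
        have hge : g e = 0 := by
          by_contra hge
          refine hcon g hgs hge (lt_of_le_of_lt ?_ hC')
          intro i hi
          exact by_contra fun hn => hi (hg i hn)
        refine hcon (fun i => f i - f j / g j * g i) ?_ ?_ ?_
        · simp only [sub_smul, Finset.sum_sub_distrib, mul_smul, ← Finset.smul_sum, hf, hgs]
          simp
        · simpa [hge] using he
        · refine (Set.ssubset_iff_of_subset ?_).2 ⟨j, ?_, ?_⟩
          · intro i hi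
            by_contra hfi
            have hfi : f i = 0 := by simpa using hfi
            have hgi : g i = 0 := hg i fun hiC => (hC'.1 hiC) hfi
            simp [hfi, hgi] at hi
          · exact hC'.1 (by_contra fun hn => hj (hg j hn))
          · simp [hj]
      obtain ⟨g, hgs, hge, hss⟩ := this
      obtain ⟨C, h1, h2, h3⟩ := ih _ (h ▸ Set.ncard_lt_ncard hss) g hgs hge rfl
      exact ⟨C, h1, h2, fun i hi => hss.1 (h3 i hi)⟩

theorem exists_depCircuit_subset {v : α → M} {S : Set α} (hS : ¬ LinearIndepOn ℝ v S) :
    ∃ C, DepCircuit v C ∧ C ⊆ S ∧ C.Nonempty := by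
  rw [linearIndepOn_iff_forall_sum] at hS
  push Not at hS
  obtain ⟨f, hf, hs, j, hj⟩ := hS
  obtain ⟨C, h1, h2, h3⟩ := exists_depCircuit_of_dependency f hs hj
  exact ⟨C, h1, fun i hi => by_contra fun hn => h3 i hi (hf i hn), j, h2⟩

theorem DepCircuit.strong_elimination {v : α → M} {C₁ C₂ : Set α} (h₁ : DepCircuit v C₁)
    (h₂ : DepCircuit v C₂) {e f : α} (hf₁ : f ∈ C₁) (hf₂ : f ∈ C₂) (he₁ : e ∈ C₁)
    (he₂ : e ∉ C₂) : ∃ C, DepCircuit v C ∧ e ∈ C ∧ C ⊆ (C₁ ∪ C₂) \ {f} := by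
  obtain ⟨d₁, hd₁, hs₁⟩ := h₁.exists_dependency
  obtain ⟨d₂, hd₂, hs₂⟩ := h₂.exists_dependency
  have hd₂e : d₂ e = 0 := by_contra fun h => he₂ ((hd₂ e).1 h)
  have hd₂f : d₂ f ≠ 0 := (hd₂ f).2 hf₂
  obtain ⟨C, h1, h2, h3⟩ := exists_depCircuit_of_dependency (v := v)
    (fun i => d₁ i - d₁ f / d₂ f * d₂ i) (e := e)
    (by simp only [sub_smul, Finset.sum_sub_distrib, mul_smul, ← Finset.smul_sum, hs₁, hs₂]
        simp)
    (by simpa [hd₂e] using (hd₁ e).2 he₁)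
  refine ⟨C, h1, h2, fun i hi => ⟨?_, ?_⟩⟩
  · by_contra hn
    simp only [Set.mem_union, not_or] at hn
    have a1 : d₁ i = 0 := by_contra fun h => hn.1 ((hd₁ i).1 h)
    have a2 : d₂ i = 0 := by_contra fun h => hn.2 ((hd₂ i).1 h)
    exact h3 i hi (by simp [a1, a2])
  · rintro rfl
    exact h3 i hi (by simp [hd₂f])

/-- Two circuits that meet can be merged: any element of the first lies on a common circuit
with any element of the second. -/
theorem DepCircuit.exists_common {v : α → M} {C₁ C₂ : Set α} (h₁ : DepCircuit v C₁)
    (h₂ : DepCircuit v C₂) (h : (C₁ ∩ C₂).Nonempty) {e g : α} (he : e ∈ C₁) (hg : g ∈ C₂) :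
    ∃ C, DepCircuit v C ∧ e ∈ C ∧ g ∈ C ∧ C ⊆ C₁ ∪ C₂ := by
  by_contra hcon
  induction hn : (C₁ ∪ C₂).ncard using Nat.strong_induction_on generalizing C₁ C₂ with
  | _ n ih =>
    obtain ⟨f, hf₁, hf₂⟩ := h
    have he₂ : e ∉ C₂ := fun h => hcon ⟨C₂, h₂, h, hg, Set.subset_union_right⟩
    have hg₁ : g ∉ C₁ := fun h => hcon ⟨C₁, h₁, he, h, Set.subset_union_left⟩
    obtain ⟨C₃, h₃, he₃, hs₃⟩ := h₁.strong_elimination h₂ hf₁ hf₂ he he₂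
    obtain ⟨C₄, h₄, hg₄, hs₄⟩ := h₂.strong_elimination h₁ hf₂ hf₁ hg hg₁
    have hs₃' : C₃ ⊆ C₁ ∪ C₂ := fun x hx => (hs₃ hx).1
    have hs₄' : C₄ ⊆ C₁ ∪ C₂ := fun x hx => (hs₄ hx).1.symm
    have hu : ∀ D₁ D₂ : Set α, DepCircuit v D₁ → DepCircuit v D₂ → (D₁ ∩ D₂).Nonempty →
        e ∈ D₁ → g ∈ D₂ → D₁ ∪ D₂ ⊆ C₁ ∪ C₂ → C₁ ∪ C₂ ⊆ D₁ ∪ D₂ := by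
      intro D₁ D₂ hD₁ hD₂ hne heD hgD hsub
      by_contra hns
      exact ih _ (hn ▸ Set.ncard_lt_ncard ⟨hsub, hns⟩) hD₁ hD₂ hne heD hgD
        (fun ⟨C, a, b, c, d⟩ => hcon ⟨C, a, b, c, d.trans hsub⟩) rfl
    have hx₃ : ∃ x ∈ C₃, x ∈ C₂ ∧ x ∉ C₁ := by
      by_contra hno
      push Not at hno
      have : C₃ ⊆ C₁ := fun x hx => (hs₃' hx).elim id fun hx2 => hno x hx hx2
      have := h₃.eq_of_subset h₁ this
      exact (hs₃ (this ▸ hf₁)).2 rfl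
    have hx₄ : ∃ x ∈ C₄, x ∈ C₁ ∧ x ∉ C₂ := by
      by_contra hno
      push Not at hno
      have : C₄ ⊆ C₂ := fun x hx => (hs₄' hx).elim (fun hx2 => hno x hx hx2) id
      have := h₄.eq_of_subset h₂ this
      exact (hs₄ (this ▸ hf₂)).2 rfl
    obtain ⟨x, hx3, hx2, hx1⟩ := hx₃
    obtain ⟨y, hy4, hy1, hy2⟩ := hx₄
    have hsub14 := hu C₁ C₄ h₁ h₄ ⟨y, hy1, hy4⟩ he hg₄
      (Set.union_subset Set.subset_union_left hs₄')
    have hx4 : x ∈ C₄ := (hsub14 (Or.inr hx2)).resolve_left hx1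
    have := hu C₃ C₄ h₃ h₄ ⟨x, hx3, hx4⟩ he₃ hg₄ (Set.union_subset hs₃' hs₄') (Or.inl hf₁)
    rcases this with h | h
    · exact (hs₃ h).2 rfl
    · exact (hs₄ h).2 rfl

end LinearDependence

theorem finrank_eq_map_add_inf_ker {M N : Type*} [AddCommGroup M] [Module ℝ M]
    [FiniteDimensional ℝ M]
    [AddCommGroup N] [Module ℝ N] (f : M →ₗ[ℝ] N) (U : Submodule ℝ M) :
    Module.finrank ℝ U = Module.finrank ℝ (U.map f) +
      Module.finrank ℝ (U ⊓ LinearMap.ker f : Submodule ℝ M) := by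
  rw [← LinearMap.finrank_range_add_finrank_ker (f.domRestrict U), LinearMap.range_domRestrict,
    LinearMap.ker_domRestrict, ← Submodule.map_comap_subtype,
    Submodule.finrank_map_subtype_eq]

section Forces

variable [Fintype V]

/-- Force systems supported on `S` that are in equilibrium. -/
def equil (p : V → Fin 2 → ℝ) (S : Set V) : Submodule ℝ (V × Fin 2 → ℝ) where
  carrier := {x | (∀ v, v ∉ S → ∀ i, x (v, i) = 0) ∧ (∀ i, ∑ v, x (v, i) = 0) ∧
    ∑ v, (x (v, 0) * p v 1 - x (v, 1) * p v 0) = 0}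
  zero_mem' := by simp
  add_mem' := by
    rintro x y ⟨h1, h2, h3⟩ ⟨k1, k2, k3⟩
    refine ⟨fun v hv i => by simp [h1 v hv, k1 v hv], fun i => ?_, ?_⟩
    · simp [Finset.sum_add_distrib, h2, k2]
    · have h := congrArg₂ (· + ·) h3 k3
      simp only [add_zero, ← Finset.sum_add_distrib] at h
      rw [← h]
      refine Finset.sum_congr rfl fun v _ => ?_
      simp only [Pi.add_apply]
      ring
  smul_mem' := by
    rintro c x ⟨h1, h2, h3⟩
    refine ⟨fun v hv i => by simp [h1 v hv], fun i => ?_, ?_⟩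
    · simp [← Finset.mul_sum, h2]
    · rw [← mul_zero c, ← h3, Finset.mul_sum]
      refine Finset.sum_congr rfl fun v _ => ?_
      simp only [Pi.smul_apply, smul_eq_mul]
      ring

theorem equil_inf_le (p : V → Fin 2 → ℝ) (A B : Set V) :
    equil p A ⊓ equil p B ≤ equil p (A ∩ B) := by
  rintro x ⟨⟨h1, h2⟩, ⟨k1, -⟩⟩
  refine ⟨fun v hv i => ?_, h2⟩
  by_cases hA : v ∈ A
  · exact k1 v (fun hB => hv ⟨hA, hB⟩) i
  · exact h1 v hA i

end Forces

/-- Evaluation of a force system at one vertex. -/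
def forceAt (v : V) : (V × Fin 2 → ℝ) →ₗ[ℝ] (Fin 2 → ℝ) := LinearMap.funLeft ℝ ℝ fun i => (v, i)

theorem forceAt_apply (v : V) (x : V × Fin 2 → ℝ) (i : Fin 2) : forceAt v x i = x (v, i) := rfl

section Rows

variable [DecidableEq V]

/-- The row of the rigidity matrix of an unordered pair. -/
def row (p : V → Fin 2 → ℝ) : Sym2 V → V × Fin 2 → ℝ :=
  Sym2.lift ⟨fun u v => edgeVec p u v, by
    intro u v
    funext ⟨w, i⟩
    simp only [edgeVec]
    split_ifs with h1 h2
    · rw [← h1, ← h2]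
    · rfl
    · rfl
    · rfl⟩

theorem row_mk (p : V → Fin 2 → ℝ) (u v : V) : row p s(u, v) = edgeVec p u v := rfl

theorem rankAt_eq (p : V → Fin 2 → ℝ) (F : Set (Sym2 V)) :
    rankAt 2 p F = Module.finrank ℝ (Submodule.span ℝ (row p '' F)) := by
  rw [rankAt]
  suffices h : {x | ∃ u v : V, s(u, v) ∈ F ∧ x = edgeVec p u v} = row p '' F by rw [h]
  ext x
  constructor
  · rintro ⟨u, v, h, rfl⟩
    exact ⟨_, h, rfl⟩
  · rintro ⟨e, he, rfl⟩
    induction e with | _ u v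
    exact ⟨u, v, he, rfl⟩

theorem row_apply_left (p : V → Fin 2 → ℝ) (u v : V) (i : Fin 2) :
    row p s(u, v) (u, i) = p u i - p v i := by
  simp [row_mk, edgeVec]

theorem row_apply_right (p : V → Fin 2 → ℝ) (u v : V) (i : Fin 2) :
    row p s(u, v) (v, i) = p v i - p u i := by
  rw [Sym2.eq_swap, row_apply_left]

theorem row_apply_of_notMem (p : V → Fin 2 → ℝ) {e : Sym2 V} {w : V} (h : w ∉ e) (i : Fin 2) :
    row p e (w, i) = 0 := by
  induction e with | _ u v
  simp only [Sym2.mem_iff, not_or] at h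
  simp [row_mk, edgeVec, h.1, h.2]

/-- The edges of the complete graph on a vertex set. -/
def cliqueEdges (S : Set V) : Set (Sym2 V) := {e | ¬ e.IsDiag ∧ ∀ v ∈ e, v ∈ S}

/-- Placements for which no three vertices are collinear and whose rigidity matrix has the
generic rank on every edge set. -/
structure GoodPlacement (p : V → Fin 2 → ℝ) : Prop where
  injective : Function.Injective p
  noncollinear : ∀ a b c, a ≠ b → a ≠ c → b ≠ c →
    (p a 0 - p b 0) * (p a 1 - p c 1) - (p a 1 - p b 1) * (p a 0 - p c 0) ≠ 0
  rank_eq : ∀ F, rankAt 2 p F = rd 2 F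

theorem edgeVec_eq (p : V → Fin 2 → ℝ) {u v : V} (h : u ≠ v) (w : V) (i : Fin 2) :
    edgeVec p u v (w, i) = (if w = u then p u i - p v i else 0) +
      (if w = v then p v i - p u i else 0) := by
  simp only [edgeVec]
  split_ifs with h1 h2
  · exact absurd (h1.symm.trans h2) h
  all_goals simp

theorem GoodPlacement.cramer {p : V → Fin 2 → ℝ} (hp : GoodPlacement p) {v a b : V} (hva : v ≠ a)
    (hvb : v ≠ b) (hab : a ≠ b) (y : Fin 2 → ℝ) :
    ∃ s t : ℝ, ∀ i, y i = s * (p v i - p a i) + t * (p v i - p b i) := by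
  have hd := hp.noncollinear v a b hva hvb hab
  set D := (p v 0 - p a 0) * (p v 1 - p b 1) - (p v 1 - p a 1) * (p v 0 - p b 0) with hD
  refine ⟨(y 0 * (p v 1 - p b 1) - y 1 * (p v 0 - p b 0)) / D,
    ((p v 0 - p a 0) * y 1 - (p v 1 - p a 1) * y 0) / D, fun i => ?_⟩
  fin_cases i
  · simp only [Fin.zero_eta]
    field_simp
    rw [hD]; ring
  · simp only [Fin.mk_one]
    field_simp
    rw [hD]; ring

variable [Fintype V]

theorem row_mem_equil (p : V → Fin 2 → ℝ) {S : Set V} {e : Sym2 V} (h : ∀ v ∈ e, v ∈ S) :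
    row p e ∈ equil p S := by
  refine ⟨fun v hv i => row_apply_of_notMem p (fun hve => hv (h v hve)) i, ?_⟩
  induction e with | _ u v
  by_cases huv : u = v
  · subst huv
    simp [row_mk, edgeVec]
  · simp only [row_mk, edgeVec_eq p huv, add_mul, ite_mul, zero_mul, add_sub_add_comm,
      Finset.sum_add_distrib, Finset.sum_sub_distrib, Finset.sum_ite_eq', Finset.mem_univ, if_true]
    refine ⟨fun i => by ring, by ring⟩

theorem span_le_equil (p : V → Fin 2 → ℝ) {S : Set V} {F : Set (Sym2 V)}
    (h : ∀ e ∈ F, ∀ v ∈ e, v ∈ S) : Submodule.span ℝ (row p '' F) ≤ equil p S := by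
  rw [Submodule.span_le]
  rintro _ ⟨e, he, rfl⟩
  exact row_mem_equil p (h e he)

theorem equil_pair {p : V → Fin 2 → ℝ} (hp : Function.Injective p) {a b : V} (hab : a ≠ b)
    {x : V × Fin 2 → ℝ} (hx : x ∈ equil p {a, b}) : ∃ c : ℝ, x = c • row p s(a, b) := by
  obtain ⟨h1, h2, h3⟩ := hx
  have hz : ∀ v, v ≠ a → v ≠ b → ∀ i, x (v, i) = 0 := fun v ha hb => h1 v (by simp [ha, hb])
  have key : ∀ g : V → ℝ, (∀ v, v ≠ a → v ≠ b → g v = 0) → ∑ v, g v = g a + g b := by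
    intro g hg
    rw [← Finset.sum_pair hab]
    symm
    refine Finset.sum_subset (Finset.subset_univ _) fun v _ hv => ?_
    simp only [Finset.mem_insert, Finset.mem_singleton, not_or] at hv
    exact hg v hv.1 hv.2
  have e0 := h2 0
  have e1 := h2 1
  rw [key _ fun v ha hb => hz v ha hb _] at e0 e1
  rw [key _ fun v ha hb => by rw [hz v ha hb, hz v ha hb]; ring] at h3
  have b0 : x (b, 0) = - x (a, 0) := by linarith
  have b1 : x (b, 1) = - x (a, 1) := by linarith
  rw [b0, b1] at h3
  have hpar : x (a, 0) * (p a 1 - p b 1) = x (a, 1) * (p a 0 - p b 0) := by linarith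
  have hne : p a 0 - p b 0 ≠ 0 ∨ p a 1 - p b 1 ≠ 0 := by
    by_contra hcon
    push Not at hcon
    apply hab
    apply hp
    funext i
    fin_cases i
    · exact sub_eq_zero.1 hcon.1
    · exact sub_eq_zero.1 hcon.2
  have : ∃ c : ℝ, x (a, 0) = c * (p a 0 - p b 0) ∧ x (a, 1) = c * (p a 1 - p b 1) := by
    rcases hne with h | h
    · refine ⟨x (a, 0) / (p a 0 - p b 0), by field_simp, ?_⟩
      field_simp
      linarith
    · refine ⟨x (a, 1) / (p a 1 - p b 1), ?_, by field_simp⟩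
      field_simp
      linarith
  obtain ⟨c, c0, c1⟩ := this
  refine ⟨c, ?_⟩
  funext ⟨w, i⟩
  rw [Pi.smul_apply, smul_eq_mul]
  by_cases ha : w = a
  · subst ha
    rw [row_apply_left]
    fin_cases i
    · exact c0
    · exact c1
  · by_cases hb : w = b
    · subst hb
      rw [row_apply_right]
      fin_cases i
      · simp only [Fin.zero_eta]
        rw [b0, c0]; ring
      · simp only [Fin.mk_one]
        rw [b1, c1]; ring
    · rw [hz w ha hb, row_apply_of_notMem p (by simp [ha, hb]), mul_zero]

theorem finrank_equil_add_three_le {p : V → Fin 2 → ℝ} (hp : Function.Injective p)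
    {S : Finset V} (hS : 2 ≤ S.card) :
    Module.finrank ℝ (equil p (S : Set V)) + 3 ≤ 2 * S.card := by
  induction S using Finset.induction_on with
  | empty => simp at hS
  | insert v S hv ih =>
    rw [Finset.card_insert_of_notMem hv] at hS ⊢
    by_cases h2 : 2 ≤ S.card
    · have := ih h2
      rw [finrank_eq_map_add_inf_ker (forceAt v) (equil p _)]
      have h1 := Submodule.finrank_le ((equil p (↑(insert v S) : Set V)).map (forceAt v))
      simp only [Module.finrank_fintype_fun_eq_card, Fintype.card_fin] at h1
      have h3 : equil p (↑(insert v S) : Set V) ⊓ LinearMap.ker (forceAt v) ≤ equil p S := by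
        rintro x ⟨⟨k1, k2⟩, hx⟩
        refine ⟨fun w hw i => ?_, k2⟩
        by_cases hwv : w = v
        · subst hwv
          exact congrFun (LinearMap.mem_ker.1 hx) i
        · exact k1 w (by simpa [hwv] using hw) i
      have h4 := Submodule.finrank_mono h3
      omega
    · obtain ⟨a, rfl⟩ := Finset.card_eq_one.1 (show S.card = 1 by omega)
      have hne : v ≠ a := by simpa using hv
      have : equil p (↑(insert v ({a} : Finset V)) : Set V) ≤
          Submodule.span ℝ {row p s(v, a)} := by
        intro x hx
        rw [Finset.coe_insert, Finset.coe_singleton] at hx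
        obtain ⟨c, rfl⟩ := equil_pair hp hne hx
        exact Submodule.smul_mem _ _ (Submodule.mem_span_singleton_self _)
      have h1 := Submodule.finrank_mono this
      have h2 := finrank_span_le_card (R := ℝ) ({row p s(v, a)} : Set (V × Fin 2 → ℝ))
      simp at h2 ⊢
      omega

theorem GoodPlacement.two_mul_card_le {p : V → Fin 2 → ℝ} (hp : GoodPlacement p)
    {S : Finset V} (hS : 2 ≤ S.card) :
    2 * S.card ≤ Module.finrank ℝ (Submodule.span ℝ (row p '' cliqueEdges (S : Set V))) + 3 := by
  induction S using Finset.induction_on with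
  | empty => simp at hS
  | insert v S hv ih =>
    rw [Finset.card_insert_of_notMem hv] at hS ⊢
    have hrow : ∀ a ∈ S, row p s(v, a) ∈
        Submodule.span ℝ (row p '' cliqueEdges (↑(insert v S) : Set V)) := by
      intro a ha
      refine Submodule.subset_span ⟨_, ⟨?_, ?_⟩, rfl⟩
      · simp only [Sym2.mk_isDiag_iff]
        rintro rfl
        exact hv ha
      · intro w hw
        rcases Sym2.mem_iff.1 hw with rfl | rfl
        · simp
        · simp [ha]
    by_cases h2 : 2 ≤ S.card
    · have := ih h2
      rw [finrank_eq_map_add_inf_ker (forceAt v) (Submodule.span ℝ _)]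
      have h1 : (Submodule.span ℝ (row p '' cliqueEdges (↑(insert v S) : Set V))).map
          (forceAt v) = ⊤ := by
        rw [eq_top_iff]
        rintro y -
        obtain ⟨a, ha, b, hb, hab⟩ := Finset.one_lt_card.1 h2
        obtain ⟨s, t, hst⟩ := hp.cramer (v := v) (fun h => hv (h ▸ ha)) (fun h => hv (h ▸ hb)) hab y
        refine ⟨s • row p s(v, a) + t • row p s(v, b), Submodule.add_mem _
          (Submodule.smul_mem _ _ (hrow a ha)) (Submodule.smul_mem _ _ (hrow b hb)), ?_⟩
        funext i
        rw [forceAt_apply, hst]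
        simp [row_apply_left]
      have h3 : Submodule.span ℝ (row p '' cliqueEdges (S : Set V)) ≤
          Submodule.span ℝ (row p '' cliqueEdges (↑(insert v S) : Set V)) ⊓
            LinearMap.ker (forceAt v) := by
        refine le_inf (Submodule.span_mono (Set.image_mono ?_)) ?_
        · exact fun e he => ⟨he.1, fun w hw => by simp [Finset.mem_coe.1 (he.2 w hw)]⟩
        · rw [Submodule.span_le]
          rintro _ ⟨e, he, rfl⟩
          refine LinearMap.mem_ker.2 (funext fun i => ?_)
          exact row_apply_of_notMem p (fun hve => hv (he.2 v hve)) i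
      have h4 := Submodule.finrank_mono h3
      rw [h1]
      simp only [finrank_top, Module.finrank_fintype_fun_eq_card, Fintype.card_fin]
      omega
    · obtain ⟨a, rfl⟩ := Finset.card_eq_one.1 (show S.card = 1 by omega)
      have hne : v ≠ a := by simpa using hv
      have hr := hrow a (by simp)
      have : row p s(v, a) ≠ 0 := by
        intro h0
        apply hne
        apply hp.injective
        funext i
        have := congrFun h0 (v, i)
        rw [row_apply_left] at this
        exact sub_eq_zero.1 this
      have hpos : 0 < Module.finrank ℝ
          (Submodule.span ℝ (row p '' cliqueEdges (↑(insert v ({a} : Finset V)) : Set V))) := by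
        rw [Module.finrank_pos_iff_exists_ne_zero]
        exact ⟨⟨_, hr⟩, fun h => this (congrArg Subtype.val h)⟩
      simp only [Finset.card_singleton]
      omega

end Rows

theorem exists_linearIndepOn_ncard_eq {α M : Type*} [Finite α] [AddCommGroup M] [Module ℝ M]
    (v : α → M) (F : Set α) :
    ∃ T ⊆ F, LinearIndepOn ℝ v T ∧ T.ncard = Module.finrank ℝ (Submodule.span ℝ (v '' F)) := by
  obtain ⟨T, hTF, -, hspan, hT⟩ :=
    exists_linearIndepOn_extension (linearIndepOn_empty ℝ v) (Set.empty_subset F)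
  refine ⟨T, hTF, hT, ?_⟩
  have : Submodule.span ℝ (v '' F) = Submodule.span ℝ (v '' T) :=
    le_antisymm (Submodule.span_le.2 hspan) (Submodule.span_mono (Set.image_mono hTF))
  have := Fintype.ofFinite T
  have h := finrank_span_eq_card hT
  rw [← Set.image_eq_range] at h
  rw [‹Submodule.span ℝ (v '' F) = _›, h, ← Nat.card_eq_fintype_card]
  rfl

theorem linearIndepOn_iff_finrank {α M : Type*} [Finite α] [AddCommGroup M] [Module ℝ M]
    (v : α → M) (F : Set α) :
    LinearIndepOn ℝ v F ↔ Module.finrank ℝ (Submodule.span ℝ (v '' F)) = F.ncard := by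
  constructor
  · intro h
    have := Fintype.ofFinite F
    have h := finrank_span_eq_card h
    rw [← Set.image_eq_range] at h
    rw [h, ← Nat.card_eq_fintype_card]
    rfl
  · intro h
    obtain ⟨T, hTF, hT, hc⟩ := exists_linearIndepOn_ncard_eq v F
    rwa [← Set.eq_of_subset_of_ncard_le hTF (by omega)]

section Circuits

variable [DecidableEq V] {p : V → Fin 2 → ℝ}

theorem GoodPlacement.row_ne_zero (hp : GoodPlacement p) {e : Sym2 V} (he : ¬ e.IsDiag) :
    row p e ≠ 0 := by
  induction e with | _ u v
  intro h0
  apply he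
  refine hp.injective (funext fun i => ?_)
  have := congrFun h0 (u, i)
  rw [row_apply_left] at this
  exact sub_eq_zero.1 this

theorem ncard_cliqueEdges (T : Finset V) : (cliqueEdges (T : Set V)).ncard = T.card.choose 2 := by
  rw [← Sym2.card_image_offDiag, ← Set.ncard_coe_finset]
  congr 1
  ext e
  induction e with | _ u v
  rw [Finset.mem_coe, Finset.mem_image]
  constructor
  · rintro ⟨h1, h2⟩
    refine ⟨(u, v), Finset.mem_offDiag.2 ⟨h2 u (by simp), h2 v (by simp), ?_⟩, rfl⟩
    simpa using h1
  · rintro ⟨⟨a, b⟩, hab, h⟩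
    have h : s(a, b) = s(u, v) := h
    rw [Finset.mem_offDiag] at hab
    rw [← h]
    refine ⟨by simpa using hab.2.2, fun w hw => ?_⟩
    rcases Sym2.mem_iff.1 hw with rfl | rfl
    · exact hab.1
    · exact hab.2.1

variable [Fintype V]

theorem GoodPlacement.rdIndep_iff (hp : GoodPlacement p) (F : Set (Sym2 V)) :
    RdIndep 2 F ↔ LinearIndepOn ℝ (row p) F := by
  rw [RdIndep, ← hp.rank_eq, rankAt_eq, linearIndepOn_iff_finrank]

theorem GoodPlacement.rdCircuit_iff (hp : GoodPlacement p) (C : Set (Sym2 V)) :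
    RdCircuit 2 C ↔ DepCircuit (row p) C := by
  simp only [RdCircuit, DepCircuit, hp.rdIndep_iff]

theorem GoodPlacement.exists_circuit_of_not_bridge (hp : GoodPlacement p) {G : SimpleGraph V}
    {e : Sym2 V} (he : e ∈ G.edgeSet) (hb : ¬ IsRdBridge 2 G e) :
    ∃ C ⊆ G.edgeSet, DepCircuit (row p) C ∧ e ∈ C := by
  by_contra hcon
  push Not at hcon
  apply hb
  refine ⟨he, ?_⟩
  obtain ⟨T, hTF, hT, hc⟩ := exists_linearIndepOn_ncard_eq (row p) (G.edgeSet \ {e})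
  have heT : e ∉ T := fun h => (hTF h).2 rfl
  have hI : LinearIndepOn ℝ (row p) (insert e T) := by
    by_contra hdep
    obtain ⟨C, hC, hCs, -⟩ := exists_depCircuit_subset hdep
    have heC : e ∈ C := by
      by_contra heC
      refine hC.1 (hT.mono fun x hx => (hCs hx).resolve_left ?_)
      rintro rfl
      exact heC hx
    exact hcon C (fun x hx => (hCs hx).elim (fun h => h ▸ he) fun h => (hTF h).1) hC heC
  have h1 := (linearIndepOn_iff_finrank _ _).1 hI
  rw [Set.ncard_insert_of_notMem heT] at h1
  have h2 : insert e T ⊆ G.edgeSet := Set.insert_subset he fun x hx => (hTF hx).1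
  have h3 := Submodule.finrank_mono (Submodule.span_mono (R := ℝ) (Set.image_mono (f := row p) h2))
  rw [← hp.rank_eq, ← hp.rank_eq, rankAt_eq, rankAt_eq]
  have h4 : Submodule.span ℝ (row p '' G.edgeSet) ≤
      Submodule.span ℝ (row p '' (G.edgeSet \ {e})) ⊔ Submodule.span ℝ {row p e} := by
    rw [← Submodule.span_union]
    refine Submodule.span_mono ?_
    rintro _ ⟨f, hf, rfl⟩
    by_cases hfe : f = e
    · right; rw [hfe]; rfl
    · left; exact ⟨f, ⟨hf, hfe⟩, rfl⟩
  have h5 := Submodule.finrank_mono h4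
  have h6 := Submodule.finrank_add_le_finrank_add_finrank
    (Submodule.span ℝ (row p '' (G.edgeSet \ {e}))) (Submodule.span ℝ {row p e})
  have h7 := finrank_span_le_card (R := ℝ) ({row p e} : Set (V × Fin 2 → ℝ))
  simp only [Set.toFinset_singleton, Finset.card_singleton] at h7
  omega

theorem GoodPlacement.notMem_circuit_of_bridge (hp : GoodPlacement p) {G : SimpleGraph V}
    {e : Sym2 V} (hb : IsRdBridge 2 G e) {C : Set (Sym2 V)} (hCG : C ⊆ G.edgeSet)
    (hC : DepCircuit (row p) C) : e ∉ C := by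
  intro heC
  have hrank := hb.2
  obtain ⟨d, hd, hs⟩ := hC.exists_dependency
  have hmem : row p e ∈ Submodule.span ℝ (row p '' (G.edgeSet \ {e})) := by
    have hde : d e ≠ 0 := (hd e).2 heC
    have h1 : d e • row p e = - ∑ i ∈ Finset.univ.erase e, d i • row p i := by
      rw [← Finset.add_sum_erase _ _ (Finset.mem_univ e)] at hs
      exact eq_neg_of_add_eq_zero_left hs
    have h2 : d e • row p e ∈ Submodule.span ℝ (row p '' (G.edgeSet \ {e})) := by
      rw [h1]
      refine Submodule.neg_mem _ (Submodule.sum_mem _ fun i hi => ?_)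
      by_cases hi0 : d i = 0
      · simp [hi0]
      · exact Submodule.smul_mem _ _ (Submodule.subset_span
          ⟨i, ⟨hCG ((hd i).1 hi0), Finset.ne_of_mem_erase hi⟩, rfl⟩)
    have := Submodule.smul_mem _ (d e)⁻¹ h2
    rwa [smul_smul, inv_mul_cancel₀ hde, one_smul] at this
  have : Submodule.span ℝ (row p '' G.edgeSet) = Submodule.span ℝ (row p '' (G.edgeSet \ {e})) := by
    refine le_antisymm (Submodule.span_le.2 ?_) (Submodule.span_mono (Set.image_mono Set.sdiff_subset))
    rintro _ ⟨f, hf, rfl⟩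
    by_cases hfe : f = e
    · rw [hfe]; exact hmem
    · exact Submodule.subset_span ⟨f, ⟨hf, hfe⟩, rfl⟩
  rw [← hp.rank_eq, ← hp.rank_eq, rankAt_eq, rankAt_eq, this] at hrank
  omega

/-- Every vertex of a circuit has degree at least three. -/
theorem GoodPlacement.exists_third_edge (hp : GoodPlacement p) {C : Set (Sym2 V)}
    (hC : DepCircuit (row p) C) {e : Sym2 V} (he : e ∈ C) {v a b : V}
    (hve : v ∈ e) (hva : v ≠ a) (hvb : v ≠ b) (hab : a ≠ b) :
    ∃ e' ∈ C, v ∈ e' ∧ e' ≠ s(v, a) ∧ e' ≠ s(v, b) := by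
  by_contra hcon
  push Not at hcon
  obtain ⟨d, hd, hs⟩ := hC.exists_dependency
  have hne : s(v, a) ≠ s(v, b) := fun h => hab (Sym2.congr_right.1 h)
  have hz : ∀ i : Fin 2, d s(v, a) * (p v i - p a i) + d s(v, b) * (p v i - p b i) = 0 := by
    intro i
    have h := congrFun hs (v, i)
    simp only [Finset.sum_apply, Pi.smul_apply, smul_eq_mul, Pi.zero_apply] at h
    rw [← h, ← row_apply_left p v a i, ← row_apply_left p v b i,
      ← Finset.sum_pair (f := fun e => d e * row p e (v, i)) hne]
    refine Finset.sum_subset (Finset.subset_univ _) fun f _ hf => ?_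
    simp only [Finset.mem_insert, Finset.mem_singleton, not_or] at hf
    by_cases hfC : f ∈ C
    · by_cases hvf : v ∈ f
      · exact absurd (hcon f hfC hvf hf.1) hf.2
      · rw [row_apply_of_notMem p hvf, mul_zero]
    · rw [show d f = 0 from by_contra fun h => hfC ((hd f).1 h), zero_mul]
  have hD := hp.noncollinear v a b hva hvb hab
  have z0 := hz 0
  have z1 := hz 1
  have hda : d s(v, a) = 0 := by
    refine (mul_eq_zero.1 ?_).resolve_right hD
    linear_combination (p v 1 - p b 1) * z0 - (p v 0 - p b 0) * z1
  have hdb : d s(v, b) = 0 := by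
    refine (mul_eq_zero.1 ?_).resolve_right hD
    linear_combination -(p v 1 - p a 1) * z0 + (p v 0 - p a 0) * z1
  have hde := (hd e).2 he
  by_cases h1 : e = s(v, a)
  · exact hde (h1 ▸ hda)
  · exact hde (hcon e he hve h1 ▸ hdb)

theorem GoodPlacement.depCircuit_cliqueEdges (hp : GoodPlacement p) {T : Finset V}
    (hT : T.card = 4) : DepCircuit (row p) (cliqueEdges (T : Set V)) := by
  have hdep : ¬ LinearIndepOn ℝ (row p) (cliqueEdges (T : Set V)) := by
    intro h
    have h1 := (linearIndepOn_iff_finrank _ _).1 h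
    rw [ncard_cliqueEdges, hT] at h1
    have h2 := Submodule.finrank_mono (span_le_equil p (S := (T : Set V))
      (F := cliqueEdges (T : Set V)) fun e he => he.2)
    have h3 := finrank_equil_add_three_le hp.injective (S := T) (by omega)
    have : Nat.choose 4 2 = 6 := rfl
    omega
  obtain ⟨C, hC, hCs, e, he⟩ := exists_depCircuit_subset hdep
  have star : ∀ v, (∃ e ∈ C, v ∈ e) → ∀ z ∈ T, z ≠ v → s(v, z) ∈ C := by
    rintro v ⟨e, he, hve⟩ z hz hzv
    have hvT : v ∈ T := (hCs he).2 v hve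
    have hcard : ((T.erase v).erase z).card = 2 := by
      rw [Finset.card_erase_of_mem (Finset.mem_erase.2 ⟨hzv, hz⟩), Finset.card_erase_of_mem hvT, hT]
    obtain ⟨x, y, hxy, hxyT⟩ := Finset.card_eq_two.1 hcard
    have hx : x ∈ (T.erase v).erase z := by rw [hxyT]; simp
    have hy : y ∈ (T.erase v).erase z := by rw [hxyT]; simp
    simp only [Finset.mem_erase] at hx hy
    obtain ⟨e', he', hve', hx', hy'⟩ :=
      hp.exists_third_edge hC he hve (Ne.symm hx.2.1) (Ne.symm hy.2.1) hxy
    obtain ⟨w, rfl⟩ := Sym2.mem_iff_exists.1 hve'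
    have hw := hCs he'
    have hwz : w = z := by
      by_contra hwz
      have : w ∈ (T.erase v).erase z := Finset.mem_erase.2 ⟨hwz, Finset.mem_erase.2
        ⟨fun h => hw.1 (by simp [h]), hw.2 w (by simp)⟩⟩
      rw [hxyT, Finset.mem_insert, Finset.mem_singleton] at this
      rcases this with rfl | rfl
      · exact hx' rfl
      · exact hy' rfl
    exact hwz ▸ he'
  have hCeq : C = cliqueEdges (T : Set V) := by
    refine hCs.antisymm fun f hf => ?_
    induction e with | _ v z
    induction f with | _ a b
    have hvC : ∃ e ∈ C, v ∈ e := ⟨_, he, by simp⟩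
    have haC : ∃ e ∈ C, a ∈ e := by
      by_cases hav : a = v
      · exact hav ▸ hvC
      · exact ⟨_, star v hvC a (hf.2 a (by simp)) hav, by simp⟩
    exact star a haC b (hf.2 b (by simp)) fun h => hf.1 (by simp [h])
  exact hCeq ▸ hC

/-- A circuit crossing a two-vertex cut `{a, b}` avoids `ab`, and its part on either side of the
cut becomes a circuit after adding `ab`. -/
theorem GoodPlacement.two_sum (hp : GoodPlacement p) {C : Set (Sym2 V)}
    (hC : DepCircuit (row p) C) (hdiag : ∀ e ∈ C, ¬ e.IsDiag) {A B : Set V} {a b : V}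
    (hab : a ≠ b) (hAB : A ∩ B = {a, b})
    (hcov : ∀ e ∈ C, (∀ v ∈ e, v ∈ A) ∨ ∀ v ∈ e, v ∈ B)
    {e₁ : Sym2 V} (he₁ : e₁ ∈ C) (he₁B : ¬ ∀ v ∈ e₁, v ∈ B)
    {e₂ : Sym2 V} (he₂ : e₂ ∈ C) (he₂A : ¬ ∀ v ∈ e₂, v ∈ A) :
    DepCircuit (row p) (insert s(a, b) {e ∈ C | ∀ v ∈ e, v ∈ A}) := by
  classical
  obtain ⟨d, hd, hs⟩ := hC.exists_dependency
  set x := ∑ e, (if ∀ v ∈ e, v ∈ B then 0 else d e) • row p e with hx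
  have hxA : x ∈ equil p A := by
    refine Submodule.sum_mem _ fun e _ => ?_
    split_ifs with h
    · simp
    · by_cases hde : d e = 0
      · simp [hde]
      · exact Submodule.smul_mem _ _
          (row_mem_equil p ((hcov e ((hd e).1 hde)).resolve_right h))
  have hxB : x ∈ equil p B := by
    have : x = - ∑ e, (if ∀ v ∈ e, v ∈ B then d e else 0) • row p e := by
      rw [eq_neg_iff_add_eq_zero, hx, ← Finset.sum_add_distrib, ← hs]
      refine Finset.sum_congr rfl fun e _ => ?_
      split_ifs <;> simp
    rw [this]
    refine Submodule.neg_mem _ (Submodule.sum_mem _ fun e _ => ?_)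
    split_ifs with h
    · exact Submodule.smul_mem _ _ (row_mem_equil p h)
    · simp
  obtain ⟨c, hc⟩ := equil_pair hp.injective hab (hAB ▸ equil_inf_le p A B ⟨hxA, hxB⟩)
  have he₂B : ∀ v ∈ e₂, v ∈ B := (hcov e₂ he₂).resolve_left he₂A
  -- the dependency between the part of `C` on the `A` side and `ab`
  have hrel : ∀ t : ℝ, ∑ e, ((if ∀ v ∈ e, v ∈ B then 0 else d e) -
      (if e = s(a, b) then t else 0)) • row p e = (c - t) • row p s(a, b) := by
    intro t
    simp only [sub_smul, Finset.sum_sub_distrib, ite_smul, zero_smul, Finset.sum_ite_eq',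
      Finset.mem_univ, if_true]
    rw [← hc, hx]
    simp only [ite_smul, zero_smul]
  have hc0 : c ≠ 0 := by
    rintro rfl
    have h1 := (linearIndepOn_iff_forall_sum (row p) (C \ {e₂})).1
      (hC.2 _ (Set.sdiff_singleton_ssubset.2 he₂))
      (fun e => if ∀ v ∈ e, v ∈ B then 0 else d e) ?_ (by rw [← hx, hc, zero_smul]) e₁
    · simp only [if_neg he₁B] at h1
      exact (hd e₁).2 he₁ h1
    · intro e he
      by_cases hee : e = e₂
      · rw [hee, if_pos he₂B]
      · split_ifs
        · rfl
        · exact by_contra fun h => he ⟨(hd e).1 h, hee⟩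
  have haA : a ∈ A ∩ B := hAB ▸ Set.mem_insert a {b}
  have hbA : b ∈ A ∩ B := hAB ▸ Set.mem_insert_of_mem a rfl
  have habA : ∀ v ∈ s(a, b), v ∈ A := by simpa using ⟨haA.1, hbA.1⟩
  have habB : ∀ v ∈ s(a, b), v ∈ B := by simpa using ⟨haA.2, hbA.2⟩
  have hindep := (linearIndepOn_iff_forall_sum (row p) (C \ {e₂})).1
    (hC.2 _ (Set.sdiff_singleton_ssubset.2 he₂))
  have hee₁ : e₁ ≠ s(a, b) := fun h => he₁B (h ▸ habB)
  have hee₂ : e₂ ≠ s(a, b) := fun h => he₂A (h ▸ habA)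
  have habC : s(a, b) ∉ C := by
    intro habC
    have h1 := hindep _ ?_ ((hrel c).trans (by simp)) e₁
    · simp only [if_neg he₁B, if_neg hee₁, sub_zero] at h1
      exact (hd e₁).2 he₁ h1
    · intro e he
      by_cases hee : e = e₂
      · rw [hee, if_pos he₂B, if_neg hee₂, sub_zero]
      · have heC : e ∉ C := fun h => he ⟨h, hee⟩
        rw [if_neg fun h : e = s(a, b) => heC (h ▸ habC), show d e = 0 from by_contra fun h => heC ((hd e).1 h)]
        simp
  have hmem : ∀ e, e ∈ C → (∀ v ∈ e, v ∈ A) → ¬ ∀ v ∈ e, v ∈ B := by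
    intro e he hA hB
    have hall : ∀ v ∈ e, v = a ∨ v = b := fun v hv => by
      have : v ∈ A ∩ B := ⟨hA v hv, hB v hv⟩
      rw [hAB] at this
      exact this
    have hediag := hdiag e he
    induction e with | _ u w
    have hu := hall u (by simp)
    have hw := hall w (by simp)
    have huw : u ≠ w := by simpa using hediag
    have : s(u, w) = s(a, b) := by rw [Sym2.eq_iff]; grind
    exact habC (this ▸ he)
  constructor
  · intro hI
    have h1 := (linearIndepOn_iff_forall_sum _ _).1 hI _ ?_ ((hrel c).trans (by simp)) s(a, b)
    · rw [if_pos habB, if_pos rfl, zero_sub, neg_eq_zero] at h1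
      exact hc0 h1
    · intro e he
      rw [Set.mem_insert_iff, not_or] at he
      rw [if_neg he.1, sub_zero]
      split_ifs with hB
      · rfl
      · by_contra hde
        have heC := (hd e).1 hde
        exact he.2 ⟨heC, (hcov e heC).resolve_right hB⟩
  · intro C' hC'
    rw [linearIndepOn_iff_forall_sum]
    intro f hf hfs
    by_cases hfab : f s(a, b) = 0
    · refine hindep f (fun e he => ?_) hfs
      by_cases heab : e = s(a, b)
      · rw [heab, hfab]
      · refine hf e fun heC' => he ?_
        have := (hC'.1 heC').resolve_left heab
        exact ⟨this.1, fun h => he₂A (h ▸ this.2)⟩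
    · exfalso
      have hcomb : ∑ e, (((if ∀ v ∈ e, v ∈ B then 0 else d e) - (if e = s(a, b) then c else 0)) +
          c / f s(a, b) * f e) • row p e = 0 := by
        have h1 := hrel c
        rw [sub_self, zero_smul] at h1
        simp only [add_smul, Finset.sum_add_distrib, mul_smul, ← Finset.smul_sum]
        rw [h1, hfs, smul_zero, add_zero]
      have h0 := hindep _ ?_ hcomb
      · have hsub : insert s(a, b) {e ∈ C | ∀ v ∈ e, v ∈ A} ⊆ C' := by
          rintro e (rfl | ⟨heC, heA⟩)
          · by_contra h
            exact hfab (hf _ h)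
          · by_contra h
            have h2 := h0 e
            rw [hf e h, mul_zero, add_zero, if_neg fun h : e = s(a, b) => habC (h ▸ heC), sub_zero,
              if_neg (hmem e heC heA)] at h2
            exact (hd e).2 heC h2
        exact hC'.2 hsub
      · intro e he
        by_cases heab : e = s(a, b)
        · rw [heab, if_pos habB, if_pos rfl, div_mul_cancel₀ _ hfab]
          ring
        · rw [if_neg heab, sub_zero]
          by_cases hee : e = e₂
          · rw [hee, if_pos he₂B, hf e₂, mul_zero, add_zero]
            intro h
            rcases hC'.1 h with h | h
            · exact hee₂ h
            · exact he₂A h.2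
          · have heC : e ∉ C := fun h => he ⟨h, hee⟩
            rw [show d e = 0 from by_contra fun h => heC ((hd e).1 h), hf e, mul_zero, ite_self,
              add_zero]
            intro h
            rcases hC'.1 h with h | h
            · exact heab h
            · exact heC h.1

end Circuits

/-- `(A, B)` is a separation of the graph on vertex set `S` with edge set `K`. -/
structure Sep (K : Set (Sym2 V)) (S A B : Set V) : Prop where
  union : A ∪ B = S
  left : (A \ B).Nonempty
  right : (B \ A).Nonempty
  cut : ∀ u ∈ A \ B, ∀ w ∈ B \ A, s(u, w) ∉ K

/-- The graph on `S` with edge set `K` is 3-connected. -/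
def Three (K : Set (Sym2 V)) (S : Set V) : Prop :=
  4 ≤ S.ncard ∧ ∀ A B, Sep K S A B → 2 < (A ∩ B).ncard

theorem Sep.symm {K : Set (Sym2 V)} {S A B : Set V} (h : Sep K S A B) : Sep K S B A where
  union := (Set.union_comm B A).trans h.union
  left := h.right
  right := h.left
  cut u hu w hw := by
    rw [Sym2.eq_swap]
    exact h.cut w hw u hu

theorem Sep.anti {K K' : Set (Sym2 V)} {S A B : Set V} (h : Sep K S A B) (hK : K' ⊆ K) :
    Sep K' S A B :=
  ⟨h.union, h.left, h.right, fun u hu w hw hK' => h.cut u hu w hw (hK hK')⟩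

theorem Three.mono {K K' : Set (Sym2 V)} {S : Set V} (h : Three K S) (hK : K ⊆ K') :
    Three K' S :=
  ⟨h.1, fun A B hAB => h.2 A B (hAB.anti hK)⟩

/-- An edge inside `S` lies on one side of every separation of `S`. -/
theorem Sep.edge_subset {K : Set (Sym2 V)} {S A B : Set V} (h : Sep K S A B) {e : Sym2 V}
    (he : e ∈ K) (heS : ∀ v ∈ e, v ∈ S) : (∀ v ∈ e, v ∈ A) ∨ ∀ v ∈ e, v ∈ B := by
  induction e with | _ u w
  have hu : u ∈ A ∪ B := h.union ▸ heS u (by simp)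
  have hw : w ∈ A ∪ B := h.union ▸ heS w (by simp)
  have h1 := h.cut u
  have h2 := h.symm.cut u
  simp only [Sym2.mem_iff, forall_eq_or_imp, forall_eq]
  simp only [Set.mem_sdiff, Set.mem_union] at *
  grind

section Finite

variable [Finite V]

theorem Three.subset_or_subset {K : Set (Sym2 V)} {X S A B : Set V} (hX : Three K X)
    (hXS : X ⊆ S) (h : Sep K S A B) (hAB : (A ∩ B).ncard ≤ 2) : X ⊆ A ∨ X ⊆ B := by
  by_contra hcon
  rw [not_or, Set.not_subset, Set.not_subset] at hcon
  obtain ⟨⟨x, hx, hxA⟩, ⟨y, hy, hyB⟩⟩ := hcon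
  have hxy : ∀ z ∈ X, z ∈ A ∨ z ∈ B := fun z hz => by
    rw [← Set.mem_union, h.union]
    exact hXS hz
  have hsep : Sep K X (X ∩ A) (X ∩ B) := by
    refine ⟨?_, ⟨y, ⟨hy, (hxy y hy).resolve_right hyB⟩, fun h => hyB h.2⟩,
      ⟨x, ⟨hx, (hxy x hx).resolve_left hxA⟩, fun h => hxA h.2⟩, ?_⟩
    · rw [← Set.inter_union_distrib_left, Set.inter_eq_left]
      exact hxy
    · rintro u ⟨hu, hu'⟩ w ⟨hw, hw'⟩
      exact h.cut u ⟨hu.2, fun h => hu' ⟨hu.1, h⟩⟩ w ⟨hw.2, fun h => hw' ⟨hw.1, h⟩⟩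
  have h1 := hX.2 _ _ hsep
  have h2 : (X ∩ A ∩ (X ∩ B)).ncard ≤ (A ∩ B).ncard :=
    Set.ncard_le_ncard fun z hz => ⟨hz.1.2, hz.2.2⟩
  omega

theorem Sep.exists_insert {K : Set (Sym2 V)} {S A B : Set V} (h : Sep K S A B)
    (hc : 2 ≤ (A \ B).ncard) :
    ∃ B', Sep K S A B' ∧ (A ∩ B').ncard = (A ∩ B).ncard + 1 := by
  obtain ⟨x, hx, y, hy, hxy⟩ := (Set.one_lt_ncard (s := A \ B)).1 (by omega)
  refine ⟨insert x B, ⟨?_, ⟨y, hy.1, ?_⟩, ?_, ?_⟩, ?_⟩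
  · rw [← h.union]
    ext z
    simp only [Set.mem_union, Set.mem_insert_iff]
    have := hx.1
    grind
  · rintro (rfl | hyB)
    · exact hxy rfl
    · exact hy.2 hyB
  · exact h.right.mono fun z hz => ⟨Or.inr hz.1, hz.2⟩
  · rintro u ⟨hu, hu'⟩ w ⟨hw, hw'⟩
    refine h.cut u ⟨hu, fun h => hu' (Or.inr h)⟩ w ⟨?_, hw'⟩
    rcases hw with rfl | hw
    · exact absurd hx.1 hw'
    · exact hw
  · rw [Set.inter_insert_of_mem hx.1, Set.ncard_insert_of_notMem fun h => hx.2 h.2]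

/-- A set of at least four vertices which is not 3-connected has a separation of order two. -/
theorem exists_sep_of_not_three {K : Set (Sym2 V)} {S : Set V} (hS : 4 ≤ S.ncard)
    (h : ¬ Three K S) : ∃ A B, Sep K S A B ∧ (A ∩ B).ncard = 2 := by
  have key : ∀ n A B, Sep K S A B → (A ∩ B).ncard + n = 2 →
      ∃ A B, Sep K S A B ∧ (A ∩ B).ncard = 2 := by
    intro n
    induction n with
    | zero => exact fun A B hAB hn => ⟨A, B, hAB, hn⟩
    | succ n ih =>
      intro A B hAB hn
      have h1 : (A \ B).ncard + (A ∩ B).ncard = A.ncard := by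
        rw [add_comm, Set.ncard_inter_add_ncard_sdiff_eq_ncard]
      have h2 : (B \ A).ncard + A.ncard = S.ncard := by
        rw [Set.ncard_sdiff_add_ncard B A, Set.union_comm, hAB.union]
      by_cases hA : 2 ≤ (A \ B).ncard
      · obtain ⟨B', hB', hc⟩ := hAB.exists_insert hA
        exact ih A B' hB' (by omega)
      · obtain ⟨A', hA', hc⟩ := hAB.symm.exists_insert (by omega)
        exact ih B A' hA' (by rw [hc, Set.inter_comm]; omega)
  rw [Three, not_and] at h
  have h := h hS
  push Not at h
  obtain ⟨A, B, hAB, hc⟩ := h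
  exact key (2 - (A ∩ B).ncard) A B hAB (by omega)

theorem Sep.ncard_left_lt {K : Set (Sym2 V)} {S A B : Set V} (h : Sep K S A B) :
    A.ncard < S.ncard := by
  refine Set.ncard_lt_ncard ⟨h.union ▸ Set.subset_union_left, fun hSA => ?_⟩
  obtain ⟨x, hx, hxA⟩ := h.right
  exact hxA (hSA (h.union ▸ Or.inr hx))

end Finite

section Count

variable [DecidableEq V] [Fintype V] {p : V → Fin 2 → ℝ}

theorem GoodPlacement.two_mul_ncard_le (hp : GoodPlacement p) {S : Set V} (hS : 2 ≤ S.ncard) :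
    2 * S.ncard ≤ Module.finrank ℝ (Submodule.span ℝ (row p '' cliqueEdges S)) + 3 := by
  classical
  have := hp.two_mul_card_le (S := S.toFinset) (by rwa [← Set.ncard_eq_toFinset_card'])
  rwa [← Set.ncard_eq_toFinset_card', Set.coe_toFinset] at this

theorem finrank_equil_add_three_le_ncard (hp : Function.Injective p) {S : Set V}
    (hS : 2 ≤ S.ncard) : Module.finrank ℝ (equil p S) + 3 ≤ 2 * S.ncard := by
  classical
  have := finrank_equil_add_three_le hp (S := S.toFinset) (by rwa [← Set.ncard_eq_toFinset_card'])
  rwa [← Set.ncard_eq_toFinset_card', Set.coe_toFinset] at this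

theorem GoodPlacement.finrank_add_le_of_inter (hp : GoodPlacement p) {A B : Set V} {P Q : Set (Sym2 V)}
    (hP : ∀ e ∈ P, ∀ v ∈ e, v ∈ A) (hQ : ∀ e ∈ Q, ∀ v ∈ e, v ∈ B) (hAB : (A ∩ B).ncard = 2) :
    Module.finrank ℝ (Submodule.span ℝ (row p '' P)) +
      Module.finrank ℝ (Submodule.span ℝ (row p '' Q)) ≤
    Module.finrank ℝ (Submodule.span ℝ (row p '' (P ∪ Q))) + 1 := by
  obtain ⟨a, b, hab, hABe⟩ := Set.ncard_eq_two.1 hAB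
  rw [← Submodule.finrank_sup_add_finrank_inf_eq, ← Submodule.span_union, ← Set.image_union]
  have h1 : Submodule.span ℝ (row p '' P) ⊓ Submodule.span ℝ (row p '' Q) ≤
      Submodule.span ℝ {row p s(a, b)} := by
    intro x hx
    have hx' := equil_inf_le p A B ⟨span_le_equil p hP hx.1, span_le_equil p hQ hx.2⟩
    rw [hABe] at hx'
    obtain ⟨c, rfl⟩ := equil_pair hp.injective hab hx'
    exact Submodule.smul_mem _ _ (Submodule.subset_span rfl)
  have h2 := Submodule.finrank_mono h1
  have h3 := finrank_span_le_card (R := ℝ) ({row p s(a, b)} : Set (V × Fin 2 → ℝ))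
  simp only [Set.toFinset_singleton, Finset.card_singleton] at h3
  omega

/-- The rank of a union of cliques on the maximal 3-connected vertex sets of a graph. -/
theorem GoodPlacement.sum_ncard_add_one_le (hp : GoodPlacement p) {K : Set (Sym2 V)} (S : Set V)
    (𝒳 : Finset (Set V)) (hne : 𝒳.Nonempty) (hS : ∀ X ∈ 𝒳, X ⊆ S) (hthree : ∀ X ∈ 𝒳, Three K X)
    (hmax : ∀ X ∈ 𝒳, ∀ Y ⊆ S, Three K Y → X ⊆ Y → X = Y) :
    ∑ X ∈ 𝒳, X.ncard + 1 ≤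
      Module.finrank ℝ (Submodule.span ℝ (row p '' {e | ∃ X ∈ 𝒳, e ∈ cliqueEdges X})) := by
  classical
  induction hn : S.ncard using Nat.strong_induction_on generalizing S 𝒳 with
  | _ n ih =>
    obtain ⟨X₀, hX₀⟩ := hne
    have hS4 : 4 ≤ S.ncard := (hthree X₀ hX₀).1.trans (Set.ncard_le_ncard (hS X₀ hX₀))
    by_cases hST : Three K S
    · have h𝒳 : 𝒳 = {S} := by
        refine Finset.eq_singleton_iff_unique_mem.2 ⟨?_, fun X hX => ?_⟩
        · exact hmax X₀ hX₀ S subset_rfl hST (hS X₀ hX₀) ▸ hX₀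
        · exact hmax X hX S subset_rfl hST (hS X hX)
      subst h𝒳
      have := hp.two_mul_ncard_le (S := S) (by omega)
      have hE : {e | ∃ X ∈ ({S} : Finset (Set V)), e ∈ cliqueEdges X} = cliqueEdges S := by
        ext e
        simp
      rw [Finset.sum_singleton, hE]
      omega
    · obtain ⟨A, B, hAB, hc⟩ := exists_sep_of_not_three hS4 hST
      have hAS : A ⊆ S := hAB.union ▸ Set.subset_union_left
      have hBS : B ⊆ S := hAB.union ▸ Set.subset_union_right
      have hside : ∀ X ∈ 𝒳, ¬ X ⊆ A → X ⊆ B := fun X hX h =>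
        ((hthree X hX).subset_or_subset (hS X hX) hAB hc.le).resolve_left h
      have ihA := ih A.ncard (hn ▸ hAB.ncard_left_lt) A (𝒳.filter (· ⊆ A))
      have ihB := ih B.ncard (hn ▸ hAB.symm.ncard_left_lt) B (𝒳.filter (¬ · ⊆ A))
      by_cases hA : (𝒳.filter (· ⊆ A)).Nonempty
      · have ihA := ihA hA (fun X hX => (Finset.mem_filter.1 hX).2)
          (fun X hX => hthree X (Finset.mem_filter.1 hX).1)
          (fun X hX Y hY => hmax X (Finset.mem_filter.1 hX).1 Y (hY.trans hAS)) rfl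
        by_cases hB : (𝒳.filter (¬ · ⊆ A)).Nonempty
        · have ihB := ihB hB
            (fun X hX => hside X (Finset.mem_filter.1 hX).1 (Finset.mem_filter.1 hX).2)
            (fun X hX => hthree X (Finset.mem_filter.1 hX).1)
            (fun X hX Y hY => hmax X (Finset.mem_filter.1 hX).1 Y (hY.trans hBS)) rfl
          have hsum := Finset.sum_filter_add_sum_filter_not 𝒳 (· ⊆ A) Set.ncard
          have hglue := hp.finrank_add_le_of_inter (A := A) (B := B)
            (P := {e | ∃ X ∈ 𝒳.filter (· ⊆ A), e ∈ cliqueEdges X})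
            (Q := {e | ∃ X ∈ 𝒳.filter (¬ · ⊆ A), e ∈ cliqueEdges X}) ?_ ?_ hc
          · have hPQ : {e | ∃ X ∈ 𝒳.filter (· ⊆ A), e ∈ cliqueEdges X} ∪
                {e | ∃ X ∈ 𝒳.filter (¬ · ⊆ A), e ∈ cliqueEdges X} =
                {e | ∃ X ∈ 𝒳, e ∈ cliqueEdges X} := by
              ext e
              constructor
              · rintro (⟨X, hX, he⟩ | ⟨X, hX, he⟩)
                · exact ⟨X, (Finset.mem_filter.1 hX).1, he⟩
                · exact ⟨X, (Finset.mem_filter.1 hX).1, he⟩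
              · rintro ⟨X, hX, he⟩
                by_cases hXA : X ⊆ A
                · exact Or.inl ⟨X, Finset.mem_filter.2 ⟨hX, hXA⟩, he⟩
                · exact Or.inr ⟨X, Finset.mem_filter.2 ⟨hX, hXA⟩, he⟩
            rw [hPQ] at hglue
            omega
          · rintro e ⟨X, hX, he⟩ v hv
            exact (Finset.mem_filter.1 hX).2 (he.2 v hv)
          · rintro e ⟨X, hX, he⟩ v hv
            exact hside X (Finset.mem_filter.1 hX).1 (Finset.mem_filter.1 hX).2 (he.2 v hv)
        · rw [Finset.not_nonempty_iff_eq_empty, Finset.filter_eq_empty_iff] at hB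
          rwa [Finset.filter_true_of_mem fun X hX => not_not.1 (hB hX)] at ihA
      · rw [Finset.not_nonempty_iff_eq_empty, Finset.filter_eq_empty_iff] at hA
        rw [Finset.filter_true_of_mem fun X hX => hA hX] at ihB
        exact ihB ⟨X₀, hX₀⟩ (fun X hX => hside X hX (hA hX)) hthree
          (fun X hX Y hY => hmax X hX Y (hY.trans hBS)) rfl

end Count

theorem connected_iff_forall_cut {W : Type*} (H : SimpleGraph W) :
    H.Connected ↔ Nonempty W ∧ ∀ P : Set W, P.Nonempty → Pᶜ.Nonempty →
      ∃ u ∈ P, ∃ w ∉ P, H.Adj u w := by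
  constructor
  · intro h
    refine ⟨h.nonempty, ?_⟩
    rintro P ⟨x, hx⟩ ⟨y, hy⟩
    obtain ⟨q⟩ := h.preconnected x y
    obtain ⟨d, -, hd1, hd2⟩ := q.exists_boundary_dart P hx hy
    exact ⟨d.fst, hd1, d.snd, hd2, d.adj⟩
  · rintro ⟨hne, h⟩
    refine ⟨fun x y => ?_⟩
    by_contra hxy
    obtain ⟨u, hu, w, hw, huw⟩ := h {z | H.Reachable x z} ⟨x, SimpleGraph.Reachable.refl x⟩ ⟨y, hxy⟩
    exact hw (SimpleGraph.Reachable.trans hu huw.reachable)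

/-- The edge set of the augmented graph of the graph with edge set `F`. -/
def augEdges (F : Set (Sym2 V)) : Set (Sym2 V) :=
  F ∪ {e | ∃ a b, a ≠ b ∧ e = s(a, b) ∧ ∃ A B, Sep F (vertexSpan F) A B ∧ A ∩ B = {a, b}}

/-- The maximal 3-connected vertex sets of the augmented graph. -/
def threeBlocks (F : Set (Sym2 V)) : Set (Set V) :=
  {X | X ⊆ vertexSpan F ∧ Three (augEdges F) X ∧
    ∀ Y ⊆ vertexSpan F, Three (augEdges F) Y → X ⊆ Y → X = Y}

theorem Three.exists_threeBlock [Finite V] {F : Set (Sym2 V)} {Y : Set V}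
    (hY : Y ⊆ vertexSpan F) (hthree : Three (augEdges F) Y) : ∃ X ∈ threeBlocks F, Y ⊆ X := by
  obtain ⟨X, hle, hX⟩ := Finite.exists_le_maximal
    (p := fun X : Set V => X ⊆ vertexSpan F ∧ Three (augEdges F) X) ⟨hY, hthree⟩
  exact ⟨X, ⟨hX.1.1, hX.1.2, fun Z hZ hZt hXZ => hXZ.antisymm (hX.2 ⟨hZ, hZt⟩ hXZ)⟩, hle⟩

section

variable [DecidableEq V] {F : Set (Sym2 V)}

theorem not_connected_induce_iff {u w : vertexSpan F} (huw : u ≠ w)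
    (h3 : ∃ v ∈ vertexSpan F, v ≠ u ∧ v ≠ w) :
    ¬ ((componentGraph F).induce {v | v ∉ s(u, w)}).Connected ↔
      ∃ A B, Sep F (vertexSpan F) A B ∧ A ∩ B = {u.1, w.1} := by
  obtain ⟨x, hx, hxu, hxw⟩ := h3
  have hnot : ∀ z : vertexSpan F, z.1 ≠ u.1 → z.1 ≠ w.1 → z ∉ s(u, w) := by
    intro z h1 h2 h
    rcases Sym2.mem_iff.1 h with rfl | rfl
    · exact h1 rfl
    · exact h2 rfl
  rw [connected_iff_forall_cut, not_and]
  constructor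
  · intro h
    have h := h ⟨⟨⟨x, hx⟩, hnot _ hxu hxw⟩⟩
    push Not at h
    obtain ⟨P, ⟨y, hy⟩, ⟨z, hz⟩, hP⟩ := h
    set Q : Set V := {v | ∃ t ∈ P, t.1.1 = v} with hQ
    have hQu : u.1 ∉ Q := by
      rintro ⟨t, -, ht⟩
      exact t.2 (by rw [Subtype.ext ht]; simp)
    have hQw : w.1 ∉ Q := by
      rintro ⟨t, -, ht⟩
      exact t.2 (by rw [Subtype.ext ht]; simp)
    have hQmem : ∀ t : {v | v ∉ s(u, w)}, t.1.1 ∈ Q → t ∈ P := by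
      rintro t ⟨t', ht', h⟩
      rwa [← Subtype.ext (Subtype.ext h)]
    have hQsub : Q ⊆ vertexSpan F := by
      rintro _ ⟨t, -, rfl⟩
      exact t.1.2
    have huA : ∀ v, v ∈ ({u.1, w.1} : Set V) → v ∈ vertexSpan F := by
      rintro v (rfl | rfl)
      · exact u.2
      · exact w.2
    refine ⟨Q ∪ {u.1, w.1}, vertexSpan F \ Q, ⟨?_, ?_, ?_, ?_⟩, ?_⟩
    · ext v
      have := huA v
      have := @hQsub v
      simp only [Set.mem_union, Set.mem_sdiff] at *
      tauto
    · exact ⟨y.1.1, Or.inl ⟨y, hy, rfl⟩, fun h => h.2 ⟨y, hy, rfl⟩⟩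
    · refine ⟨z.1.1, ⟨z.1.2, fun h => hz (hQmem z h)⟩, ?_⟩
      rintro (h | h | h)
      · exact hz (hQmem z h)
      · exact z.2 (by rw [Subtype.ext h]; simp)
      · exact z.2 (by rw [Subtype.ext h]; simp)
    · rintro a ⟨ha, ha'⟩ b ⟨hb, hb'⟩ hab
      have haQ : a ∈ Q := by
        rcases ha with h | h
        · exact h
        · by_contra hQ
          exact ha' ⟨huA a h, hQ⟩
      obtain ⟨t, ht, rfl⟩ := haQ
      have hb2 : b ∉ ({u.1, w.1} : Set V) := fun h => hb' (Or.inr h)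
      simp only [Set.mem_insert_iff, Set.mem_singleton_iff, not_or] at hb2
      refine hP t ht ⟨⟨b, hb.1⟩, hnot _ hb2.1 hb2.2⟩ (fun h => hb.2 ⟨_, h, rfl⟩) ?_
      refine (SimpleGraph.fromEdgeSet_adj F).2 ⟨hab, fun h => hb.2 ⟨t, ht, h⟩⟩
    · ext v
      have := huA v
      simp only [Set.mem_inter_iff, Set.mem_union, Set.mem_sdiff, Set.mem_insert_iff,
        Set.mem_singleton_iff] at *
      grind
  · rintro ⟨A, B, hAB, hc⟩ - hcon
    have hu : u.1 ∈ A ∩ B := by rw [hc]; simp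
    have hw : w.1 ∈ A ∩ B := by rw [hc]; simp
    obtain ⟨x, hx, hxB⟩ := hAB.left
    obtain ⟨y, hy, hyA⟩ := hAB.right
    have hne : ∀ z, z ∉ A ∩ B → z ≠ u.1 ∧ z ≠ w.1 := fun z hz =>
      ⟨fun h => hz (h ▸ hu), fun h => hz (h ▸ hw)⟩
    have hxn := hne x fun h => hxB h.2
    have hyn := hne y fun h => hyA h.1
    obtain ⟨s, hs, t, ht, hst⟩ := hcon {z | z.1.1 ∈ A}
      ⟨⟨⟨x, hAB.union ▸ Or.inl hx⟩, hnot _ hxn.1 hxn.2⟩, hx⟩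
      ⟨⟨⟨y, hAB.union ▸ Or.inr hy⟩, hnot _ hyn.1 hyn.2⟩, hyA⟩
    have hsB : s.1.1 ∉ B := by
      intro hsB
      have : s.1.1 ∈ A ∩ B := ⟨hs, hsB⟩
      rw [hc] at this
      rcases this with h | h
      · exact s.2 (by rw [Subtype.ext h]; simp)
      · exact s.2 (by rw [Subtype.ext h]; simp)
    have htB : t.1.1 ∈ A ∪ B := by
      rw [hAB.union]
      exact t.1.2
    exact hAB.cut _ ⟨hs, hsB⟩ _ ⟨htB.resolve_left ht, ht⟩ ((SimpleGraph.fromEdgeSet_adj F).1 hst).1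

variable [Finite V]

theorem aug_adj_iff (h3 : 3 ≤ (vertexSpan F).ncard) (u w : vertexSpan F) :
    (aug (componentGraph F)).Adj u w ↔ u ≠ w ∧ s(u.1, w.1) ∈ augEdges F := by
  have hx : ∃ v ∈ vertexSpan F, v ≠ u.1 ∧ v ≠ w.1 := by
    by_contra hcon
    push Not at hcon
    have : vertexSpan F ⊆ {u.1, w.1} := fun v hv => by
      by_cases hvu : v = u.1
      · exact Or.inl hvu
      · exact Or.inr (hcon v hv hvu)
    have h1 := Set.ncard_le_ncard this
    have h2 := Set.ncard_insert_le u.1 {w.1}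
    rw [Set.ncard_singleton] at h2
    omega
  rw [aug, SimpleGraph.sup_adj, SimpleGraph.fromEdgeSet_adj, augEdges]
  constructor
  · rintro (h | ⟨h, hne⟩)
    · exact ⟨h.ne, Or.inl ((SimpleGraph.fromEdgeSet_adj F).1 h).1⟩
    · exact ⟨hne, Or.inr ⟨u.1, w.1, fun h => hne (Subtype.ext h), rfl,
        (not_connected_induce_iff hne hx).1 h.2⟩⟩
  · rintro ⟨hne, h | ⟨a, b, hab, he, A, B, hAB, hc⟩⟩
    · exact Or.inl ((SimpleGraph.fromEdgeSet_adj F).2 ⟨h, fun h => hne (Subtype.ext h)⟩)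
    · refine Or.inr ⟨⟨by simpa using hne, (not_connected_induce_iff hne hx).2 ⟨A, B, hAB, ?_⟩⟩, hne⟩
      rw [hc]
      rcases Sym2.eq_iff.1 he with ⟨h1, h2⟩ | ⟨h1, h2⟩
      · rw [h1, h2]
      · rw [h1, h2, Set.pair_comm]

theorem IsThreeConnectedSubgraph.three (h3 : 3 ≤ (vertexSpan F).ncard)
    {J : (aug (componentGraph F)).Subgraph} (hJ : IsThreeConnectedSubgraph J) :
    Three (augEdges F) (Subtype.val '' J.verts) := by
  refine ⟨by rw [Set.ncard_image_of_injective _ Subtype.val_injective]; exact hJ.1, ?_⟩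
  intro A B hAB
  by_contra hc
  have hS : (Subtype.val ⁻¹' (A ∩ B) : Set (vertexSpan F)).ncard < 3 := by
    have : (Subtype.val '' (Subtype.val ⁻¹' (A ∩ B) : Set (vertexSpan F))).ncard ≤ (A ∩ B).ncard :=
      Set.ncard_le_ncard (Set.image_preimage_subset _ _)
    rw [Set.ncard_image_of_injective _ Subtype.val_injective] at this
    omega
  have hconn := ((connected_iff_forall_cut _).1 (hJ.2 _ hS)).2 {z | z.1.1 ∈ A}
  obtain ⟨x, hx, hxB⟩ := hAB.left
  obtain ⟨y, hy, hyA⟩ := hAB.right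
  obtain ⟨j, hj, rfl⟩ : x ∈ Subtype.val '' J.verts := hAB.union ▸ Or.inl hx
  obtain ⟨k, hk, rfl⟩ : y ∈ Subtype.val '' J.verts := hAB.union ▸ Or.inr hy
  obtain ⟨u, hu, w, hw, huw⟩ := hconn ⟨⟨j, hj, fun h => hxB h.2⟩, hx⟩ ⟨⟨k, hk, fun h => hyA h.1⟩, hyA⟩
  have huw' : J.Adj u.1 w.1 := (SimpleGraph.Subgraph.deleteVerts_adj.1 huw).2.2.2.2
  have hu2 : u.1 ∈ J.verts \ Subtype.val ⁻¹' (A ∩ B) := u.2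
  have hw2 : w.1 ∈ J.verts \ Subtype.val ⁻¹' (A ∩ B) := w.2
  have hwAB : w.1.1 ∈ A ∪ B := by
    rw [hAB.union]
    exact ⟨_, hw2.1, rfl⟩
  exact hAB.cut _ ⟨hu, fun h => hu2.2 ⟨hu, h⟩⟩ _ ⟨hwAB.resolve_left hw, hw⟩
    ((aug_adj_iff h3 _ _).1 huw'.adj_sub).2

theorem Three.isThreeConnectedSubgraph {Y : Set V}
    (hY : Y ⊆ vertexSpan F) (hthree : Three (augEdges F) Y) :
    IsThreeConnectedSubgraph ((⊤ : (aug (componentGraph F)).Subgraph).induce (Subtype.val ⁻¹' Y)) := by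
  have himg : Subtype.val '' (Subtype.val ⁻¹' Y : Set (vertexSpan F)) = Y :=
    Set.image_preimage_eq_of_subset (by simpa using hY)
  have h3 : 3 ≤ (vertexSpan F).ncard := by
    have := Set.ncard_le_ncard hY
    have := hthree.1
    omega
  have hcard : 4 ≤ (Subtype.val ⁻¹' Y : Set (vertexSpan F)).ncard := by
    rw [← Set.ncard_image_of_injective _ Subtype.val_injective, himg]
    exact hthree.1
  refine ⟨hcard, fun S hS => (connected_iff_forall_cut _).2 ⟨?_, fun P hP hP' => ?_⟩⟩
  · have : ((Subtype.val ⁻¹' Y : Set (vertexSpan F)) \ S).Nonempty := by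
      rw [Set.sdiff_nonempty]
      intro h
      have := Set.ncard_le_ncard h
      omega
    exact this.to_subtype
  · by_contra hcon
    push Not at hcon
    set Q : Set V := {v | ∃ z ∈ P, z.1.1 = v} with hQ
    have hmem : ∀ z : (((⊤ : (aug (componentGraph F)).Subgraph).induce
        (Subtype.val ⁻¹' Y)).deleteVerts S).verts, z.1.1 ∈ Y ∧ z.1 ∉ S := fun z => z.2
    have hQmem : ∀ t, t.1.1 ∈ Q → t ∈ P := by
      rintro t ⟨t', ht', h⟩
      rwa [← Subtype.ext (Subtype.ext h)]
    have hQY : Q ⊆ Y := by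
      rintro _ ⟨z, -, rfl⟩
      exact (hmem z).1
    have hsep : Sep (augEdges F) Y (Q ∪ (Y ∩ Subtype.val '' S)) (Y \ Q) := by
      refine ⟨?_, ?_, ?_, ?_⟩
      · ext v
        have := @hQY v
        simp only [Set.mem_union, Set.mem_inter_iff, Set.mem_sdiff]
        tauto
      · obtain ⟨z, hz⟩ := hP
        exact ⟨z.1.1, Or.inl ⟨z, hz, rfl⟩, fun h => h.2 ⟨z, hz, rfl⟩⟩
      · obtain ⟨z, hz⟩ := hP'
        refine ⟨z.1.1, ⟨(hmem z).1, fun h => hz (hQmem z h)⟩, ?_⟩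
        rintro (h | ⟨-, s, hs, h⟩)
        · exact hz (hQmem z h)
        · exact (hmem z).2 (Subtype.ext h ▸ hs)
      · rintro u ⟨hu, hu'⟩ w ⟨hw, hw'⟩ huw
        have huQ : u ∈ Q := by
          rcases hu with h | h
          · exact h
          · by_contra hQ
            exact hu' ⟨h.1, hQ⟩
        obtain ⟨z, hz, rfl⟩ := huQ
        have hwS : (⟨w, hY hw.1⟩ : vertexSpan F) ∉ S := fun h =>
          hw' (Or.inr ⟨hw.1, _, h, rfl⟩)
        have hne : z.1 ≠ ⟨w, hY hw.1⟩ := by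
          intro h
          exact hw.2 ⟨z, hz, congrArg Subtype.val h⟩
        refine hcon z hz ⟨⟨w, hY hw.1⟩, hw.1, hwS⟩ (fun h => hw.2 ⟨_, h, rfl⟩) ?_
        refine SimpleGraph.Subgraph.deleteVerts_adj.2 ⟨(hmem z).1, (hmem z).2, hw.1, hwS, ?_⟩
        exact ⟨(hmem z).1, hw.1, (aug_adj_iff h3 _ _).2 ⟨hne, huw⟩⟩
    have h1 := hthree.2 _ _ hsep
    have h2 : ((Q ∪ (Y ∩ Subtype.val '' S)) ∩ (Y \ Q)).ncard ≤ (Subtype.val '' S).ncard := by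
      refine Set.ncard_le_ncard ?_
      rintro v ⟨h | h, h'⟩
      · exact absurd h h'.2
      · exact h.2
    rw [Set.ncard_image_of_injective _ Subtype.val_injective] at h2
    omega

theorem exists_isThreeBlock_iff (h3 : 3 ≤ (vertexSpan F).ncard)
    (X : Set V) :
    (∃ J, IsThreeBlock (componentGraph F) J ∧ X = Subtype.val '' J.verts) ↔ X ∈ threeBlocks F := by
  have hsub : ∀ J : (aug (componentGraph F)).Subgraph, Subtype.val '' J.verts ⊆ vertexSpan F := by
    rintro J _ ⟨z, -, rfl⟩
    exact z.2
  constructor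
  · rintro ⟨J, hJ, rfl⟩
    refine ⟨hsub J, hJ.1.three h3, fun Y hY hYt hXY => ?_⟩
    have h := hJ.2 _ (hYt.isThreeConnectedSubgraph hY) ⟨fun z hz => hXY ⟨z, hz, rfl⟩,
      fun u w huw => ⟨hXY ⟨u, huw.fst_mem, rfl⟩, hXY ⟨w, huw.snd_mem, rfl⟩, huw.adj_sub⟩⟩
    rw [h]
    exact Set.image_preimage_eq_of_subset (by simpa using hY)
  · rintro ⟨hX, hXt, hmax⟩
    obtain ⟨J, hle, hJ⟩ := Finite.exists_le_maximal
      (p := fun J : (aug (componentGraph F)).Subgraph => IsThreeConnectedSubgraph J)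
      (hXt.isThreeConnectedSubgraph hX)
    refine ⟨J, ⟨hJ.1, fun J' hJ' hle' => le_antisymm hle' (hJ.2 hJ' hle')⟩, ?_⟩
    exact hmax _ (hsub J) (hJ.1.three h3) fun x hx => ⟨⟨x, hX hx⟩, hle.1 hx, rfl⟩

end

theorem Sep.extend {F : Set (Sym2 V)} {S A B A₁ B₁ : Set V} {a b : V} (h : Sep F S A B)
    (hc : A ∩ B = {a, b})
    (h₁ : Sep (insert s(a, b) {e ∈ F | ∀ v ∈ e, v ∈ A}) A A₁ B₁) (ha : a ∈ A₁) (hb : b ∈ A₁) :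
    Sep F S (A₁ ∪ B) B₁ ∧ (A₁ ∪ B) ∩ B₁ = A₁ ∩ B₁ := by
  have hAB : ∀ v, v ∈ A → v ∈ B → v ∈ A₁ := by
    intro v hvA hvB
    have : v ∈ A ∩ B := ⟨hvA, hvB⟩
    rw [hc] at this
    rcases this with rfl | rfl
    · exact ha
    · exact hb
  have hB₁ : ∀ v, v ∈ B₁ → v ∈ A := fun v hv => h₁.union ▸ Or.inr hv
  refine ⟨⟨?_, ?_, ?_, ?_⟩, ?_⟩
  · rw [← h.union, ← h₁.union, Set.union_right_comm]
  · exact h₁.left.mono fun v hv => ⟨Or.inl hv.1, hv.2⟩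
  · refine h₁.right.mono fun v hv => ⟨hv.1, ?_⟩
    rintro (h | h)
    · exact hv.2 h
    · exact hv.2 (hAB v (hB₁ v hv.1) h)
  · rintro u ⟨hu, hu'⟩ w ⟨hw, hw'⟩ huw
    have hwB : w ∉ B := fun h => hw' (Or.inr h)
    have hwA₁ : w ∉ A₁ := fun h => hw' (Or.inl h)
    have huA : u ∈ A := by
      by_contra huA
      have huB : u ∈ B := hu.resolve_left fun h => huA (h₁.union ▸ Or.inl h)
      exact h.cut w ⟨hB₁ w hw, hwB⟩ u ⟨huB, huA⟩ (Sym2.eq_swap ▸ huw)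
    refine h₁.cut u ⟨hu.elim id (hAB u huA), hu'⟩ w ⟨hw, hwA₁⟩ (Or.inr ⟨huw, ?_⟩)
    simpa using ⟨huA, hB₁ w hw⟩
  · ext v
    have := hAB v
    have := hB₁ v
    simp only [Set.mem_inter_iff, Set.mem_union]
    tauto

theorem Sep.augEdges_subset {F : Set (Sym2 V)} {A B : Set V} {a b : V} (hab : a ≠ b)
    (h : Sep F (vertexSpan F) A B) (hc : A ∩ B = {a, b})
    (hspan : vertexSpan (insert s(a, b) {e ∈ F | ∀ v ∈ e, v ∈ A}) = A) :
    augEdges (insert s(a, b) {e ∈ F | ∀ v ∈ e, v ∈ A}) ⊆ augEdges F := by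
  rintro e ((rfl | he) | ⟨c, d, hcd, rfl, A₁, B₁, h₁, hc₁⟩)
  · exact Or.inr ⟨a, b, hab, rfl, A, B, h, hc⟩
  · exact Or.inl he.1
  · rw [hspan] at h₁
    have haA : a ∈ A ∩ B := by rw [hc]; simp
    have hbA : b ∈ A ∩ B := by rw [hc]; simp
    refine Or.inr ⟨c, d, hcd, rfl, ?_⟩
    rcases h₁.edge_subset (Set.mem_insert s(a, b) _) (by simpa using ⟨haA.1, hbA.1⟩) with h2 | h2
    · obtain ⟨h3, h4⟩ := h.extend hc h₁ (h2 a (by simp)) (h2 b (by simp))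
      exact ⟨_, _, h3, h4.trans hc₁⟩
    · obtain ⟨h3, h4⟩ := h.extend hc h₁.symm (h2 a (by simp)) (h2 b (by simp))
      exact ⟨_, _, h3, h4.trans ((Set.inter_comm _ _).trans hc₁)⟩

theorem Sep.vertexSpan_side {F : Set (Sym2 V)} {A B : Set V} {a b : V}
    (h : Sep F (vertexSpan F) A B) (hc : A ∩ B = {a, b}) :
    vertexSpan (insert s(a, b) {e ∈ F | ∀ v ∈ e, v ∈ A}) = A := by
  have haA : a ∈ A ∩ B := by rw [hc]; simp
  have hbA : b ∈ A ∩ B := by rw [hc]; simp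
  ext v
  constructor
  · rintro ⟨e, rfl | he, hv⟩
    · rcases Sym2.mem_iff.1 hv with rfl | rfl
      · exact haA.1
      · exact hbA.1
    · exact he.2 v hv
  · intro hv
    obtain ⟨e, he, hve⟩ : v ∈ vertexSpan F := h.union ▸ Or.inl hv
    rcases h.edge_subset he fun w hw => ⟨e, he, hw⟩ with h1 | h1
    · exact ⟨e, Or.inr ⟨he, h1⟩, hve⟩
    · have : v ∈ A ∩ B := ⟨hv, h1 v hve⟩
      rw [hc] at this
      refine ⟨s(a, b), Or.inl rfl, Sym2.mem_iff.2 this⟩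

theorem Sep.exists_edge_notMem_right {F : Set (Sym2 V)} {A B : Set V}
    (h : Sep F (vertexSpan F) A B) : ∃ e ∈ F, ¬ ∀ v ∈ e, v ∈ B := by
  obtain ⟨x, hx, hxB⟩ := h.left
  obtain ⟨e, he, hxe⟩ : x ∈ vertexSpan F := h.union ▸ Or.inl hx
  exact ⟨e, he, fun h => hxB (h x hxe)⟩

section Conn

variable [DecidableEq V]

/-- Any two edges of `F` lie on a common circuit of the rigidity matrix inside `F`. -/
def CircuitConn (p : V → Fin 2 → ℝ) (F : Set (Sym2 V)) : Prop :=
  ∀ e ∈ F, ∀ f ∈ F, e = f ∨ ∃ C ⊆ F, DepCircuit (row p) C ∧ e ∈ C ∧ f ∈ C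

theorem CircuitConn.exists_circuit_mem {p : V → Fin 2 → ℝ} {F : Set (Sym2 V)}
    (hF : CircuitConn p F) (h2 : 2 ≤ F.ncard) {e : Sym2 V} (he : e ∈ F) :
    ∃ C ⊆ F, DepCircuit (row p) C ∧ e ∈ C := by
  obtain ⟨f, hf, hfe⟩ := Set.exists_ne_of_one_lt_ncard (s := F) (by omega) e
  obtain ⟨C, hC, hCC, heC, -⟩ := (hF e he f hf).resolve_left hfe.symm
  exact ⟨C, hC, hCC, heC⟩

variable [Fintype V] {p : V → Fin 2 → ℝ} {F : Set (Sym2 V)}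

theorem GoodPlacement.four_le_ncard_vertexSpan (hp : GoodPlacement p)
    (hdiag : ∀ e ∈ F, ¬ e.IsDiag) {C : Set (Sym2 V)} (hC : DepCircuit (row p) C) (hCF : C ⊆ F) :
    4 ≤ (vertexSpan F).ncard := by
  classical
  by_contra hcon
  set S := (vertexSpan F).toFinset with hS
  have hSc : (S : Set V) = vertexSpan F := Set.coe_toFinset _
  have hcard : (vertexSpan F).ncard = S.card := Set.ncard_eq_toFinset_card' _
  have hFS : F ⊆ cliqueEdges (S : Set V) := fun e he =>
    ⟨hdiag e he, fun v hv => hSc ▸ ⟨e, he, hv⟩⟩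
  have hne : C.Nonempty := by
    by_contra h
    rw [Set.not_nonempty_iff_eq_empty] at h
    exact hC.1 (h ▸ linearIndepOn_empty ℝ _)
  obtain ⟨e, he⟩ := hne
  have h2 : 2 ≤ S.card := by
    have hed := hdiag e (hCF he)
    have heS := (hFS (hCF he)).2
    induction e with | _ u w
    exact Finset.one_lt_card.2 ⟨u, by simpa using heS u (by simp), w, by simpa using heS w (by simp),
      by simpa using hed⟩
  have h3 := hp.two_mul_card_le h2
  obtain ⟨T, hT, hTi, hTc⟩ := exists_linearIndepOn_ncard_eq (row p) (cliqueEdges (S : Set V))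
  have h4 := ncard_cliqueEdges S
  have h5 : T.ncard ≤ (cliqueEdges (S : Set V)).ncard := Set.ncard_le_ncard hT
  have h6 : S.card.choose 2 + 3 = 2 * S.card := by
    have : S.card = 2 ∨ S.card = 3 := by omega
    rcases this with h | h <;> rw [h] <;> rfl
  have h7 := (linearIndepOn_iff_finrank (row p) (cliqueEdges (S : Set V))).2 (by omega)
  exact hC.1 (h7.mono (hCF.trans hFS))

/-- The circuit through `s(a, b)` and a given edge on one side of a two-vertex cut `{a, b}`. -/
theorem CircuitConn.exists_circuit_side (hp : GoodPlacement p) (hF : CircuitConn p F)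
    (hdiag : ∀ e ∈ F, ¬ e.IsDiag) {A B : Set V} {a b : V} (hab : a ≠ b)
    (h : Sep F (vertexSpan F) A B) (hc : A ∩ B = {a, b}) {f : Sym2 V} (hf : f ∈ F)
    (hfB : ¬ ∀ v ∈ f, v ∈ B) :
    ∃ C ⊆ insert s(a, b) {e ∈ F | ∀ v ∈ e, v ∈ A}, DepCircuit (row p) C ∧ s(a, b) ∈ C ∧ f ∈ C := by
  have hcov : ∀ e ∈ F, (∀ v ∈ e, v ∈ A) ∨ ∀ v ∈ e, v ∈ B := fun e he =>
    h.edge_subset he fun v hv => ⟨e, he, hv⟩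
  obtain ⟨e₂, he₂, he₂A⟩ := h.symm.exists_edge_notMem_right
  have hfA := (hcov f hf).resolve_right hfB
  have hne : f ≠ e₂ := by
    rintro rfl
    exact he₂A hfA
  obtain ⟨C, hCF, hC, hfC, he₂C⟩ := (hF f hf e₂ he₂).resolve_left hne
  refine ⟨_, ?_, hp.two_sum hC (fun e he => hdiag e (hCF he)) hab hc (fun e he => hcov e (hCF he))
    hfC hfB he₂C he₂A, Set.mem_insert _ _, Or.inr ⟨hfC, hfA⟩⟩
  exact Set.insert_subset_insert fun e he => ⟨hCF he.1, he.2⟩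

theorem CircuitConn.side (hp : GoodPlacement p) (hF : CircuitConn p F)
    (hdiag : ∀ e ∈ F, ¬ e.IsDiag) {A B : Set V} {a b : V} (hab : a ≠ b)
    (h : Sep F (vertexSpan F) A B) (hc : A ∩ B = {a, b}) :
    CircuitConn p (insert s(a, b) {e ∈ F | ∀ v ∈ e, v ∈ A}) := by
  have key : ∀ f ∈ insert s(a, b) {e ∈ F | ∀ v ∈ e, v ∈ A}, f ≠ s(a, b) →
      ∃ C ⊆ insert s(a, b) {e ∈ F | ∀ v ∈ e, v ∈ A},
        DepCircuit (row p) C ∧ s(a, b) ∈ C ∧ f ∈ C := by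
    intro f hf hne
    have hf := hf.resolve_left hne
    refine hF.exists_circuit_side hp hdiag hab h hc hf.1 fun hfB => hne ?_
    have hall : ∀ v ∈ f, v = a ∨ v = b := fun v hv => by
      have : v ∈ A ∩ B := ⟨hf.2 v hv, hfB v hv⟩
      rw [hc] at this
      exact this
    have hfd := hdiag f hf.1
    induction f with | _ u w
    have hu := hall u (by simp)
    have hw := hall w (by simp)
    have huw : u ≠ w := by simpa using hfd
    rw [Sym2.eq_iff]
    grind
  intro e he f hf
  by_cases hef : e = f
  · exact Or.inl hef
  refine Or.inr ?_
  by_cases hea : e = s(a, b)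
  · obtain ⟨C, h1, h2, h3, h4⟩ := key f hf (hea ▸ Ne.symm hef)
    exact ⟨C, h1, h2, hea ▸ h3, h4⟩
  · obtain ⟨C, h1, h2, h3, h4⟩ := key e he hea
    by_cases hfa : f = s(a, b)
    · exact ⟨C, h1, h2, h4, hfa ▸ h3⟩
    · obtain ⟨D, k1, k2, k3, k4⟩ := key f hf hfa
      obtain ⟨E, hE, heE, hfE, hEs⟩ := h2.exists_common k2 ⟨_, h3, k3⟩ h4 k4
      exact ⟨E, hEs.trans (Set.union_subset h1 k1), hE, heE, hfE⟩

/-- Every vertex of a connected edge set lies in a 3-connected piece. -/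
theorem CircuitConn.exists_three (hp : GoodPlacement p) (hF : CircuitConn p F)
    (hdiag : ∀ e ∈ F, ¬ e.IsDiag) (h2 : 2 ≤ F.ncard) {y : V} (hy : y ∈ vertexSpan F) :
    ∃ Y ⊆ vertexSpan F, Three (augEdges F) Y ∧ y ∈ Y := by
  induction hn : (vertexSpan F).ncard using Nat.strong_induction_on generalizing F with
  | _ n ih =>
    obtain ⟨e, he, hye⟩ := id hy
    obtain ⟨C, hCF, hC, -⟩ := hF.exists_circuit_mem h2 he
    have h4 := hp.four_le_ncard_vertexSpan hdiag hC hCF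
    by_cases hT : Three (augEdges F) (vertexSpan F)
    · exact ⟨_, subset_rfl, hT, hy⟩
    obtain ⟨A, B, hAB', hc⟩ := exists_sep_of_not_three h4 hT
    have hAB := hAB'.anti (K' := F) Set.subset_union_left
    have key : ∀ A B, Sep F (vertexSpan F) A B → (A ∩ B).ncard = 2 → y ∈ A →
        ∃ Y ⊆ vertexSpan F, Three (augEdges F) Y ∧ y ∈ Y := by
      intro A B hAB hc hyA
      obtain ⟨a, b, hab, hc⟩ := Set.ncard_eq_two.1 hc
      have hspan := hAB.vertexSpan_side hc
      have hdiag' : ∀ e ∈ insert s(a, b) {e ∈ F | ∀ v ∈ e, v ∈ A}, ¬ e.IsDiag := by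
        rintro e (rfl | he)
        · simpa using hab
        · exact hdiag e he.1
      have hcard : 2 ≤ (insert s(a, b) {e ∈ F | ∀ v ∈ e, v ∈ A}).ncard := by
        obtain ⟨f, hf, hfB⟩ := hAB.exists_edge_notMem_right
        have hfA := (hAB.edge_subset hf fun v hv => ⟨f, hf, hv⟩).resolve_right hfB
        have hbB : b ∈ A ∩ B := by rw [hc]; simp
        have haB : a ∈ A ∩ B := by rw [hc]; simp
        refine (Set.one_lt_ncard (s := insert s(a, b) {e ∈ F | ∀ v ∈ e, v ∈ A})).2
          ⟨s(a, b), Or.inl rfl, f, Or.inr ⟨hf, hfA⟩, ?_⟩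
        rintro rfl
        exact hfB (by simpa using ⟨haB.2, hbB.2⟩)
      obtain ⟨Y, hY, hYt, hyY⟩ := ih A.ncard (hn ▸ hAB.ncard_left_lt)
        (hF.side hp hdiag hab hAB hc) hdiag' hcard (hspan.symm ▸ hyA) (by rw [hspan])
      rw [hspan] at hY
      exact ⟨Y, hY.trans (hAB.union ▸ Set.subset_union_left),
        hYt.mono (hAB.augEdges_subset hab hc hspan), hyY⟩
    have hyAB : y ∈ A ∪ B := hAB.union.symm ▸ hy
    rcases hyAB with h | h
    · exact key A B hAB hc h
    · exact key B A hAB.symm (by rw [Set.inter_comm, hc]) h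

/-- If `F` is closed under the circuits inside `E` and `E` contains the clique on a 3-connected
piece of `F`, then so does `F`. -/
theorem CircuitConn.cliqueEdges_subset (hp : GoodPlacement p) (hF : CircuitConn p F)
    (hdiag : ∀ e ∈ F, ¬ e.IsDiag) {E : Set (Sym2 V)} (hFE : F ⊆ E)
    (hclosed : ∀ C ⊆ E, DepCircuit (row p) C → (C ∩ F).Nonempty → C ⊆ F) {X : Set V}
    (hX : Three (augEdges F) X) (hXE : cliqueEdges X ⊆ E) : cliqueEdges X ⊆ F := by
  classical
  have hedge : ∃ e ∈ cliqueEdges X, e ∈ augEdges F := by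
    by_contra hcon
    push Not at hcon
    have h4 := hX.1
    obtain ⟨x, hx, y, hy, hxy⟩ := (Set.one_lt_ncard (s := X)).1 (by omega)
    have := hX.2 {x} (X \ {x}) ⟨?_, ⟨x, rfl, fun h => h.2 rfl⟩, ⟨y, ⟨hy, Ne.symm hxy⟩, Ne.symm hxy⟩, ?_⟩
    · simp at this
    · simpa using hx
    · rintro u ⟨rfl, -⟩ w ⟨⟨hw, hwu⟩, -⟩
      refine hcon _ ⟨?_, ?_⟩
      · simpa using Ne.symm hwu
      · simpa using ⟨hx, hw⟩
  obtain ⟨e, heX, he⟩ := hedge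
  have heF : e ∈ F := by
    rcases he with he | ⟨a, b, hab, rfl, A, B, hAB, hc⟩
    · exact he
    · obtain ⟨f, hf, hfB⟩ := hAB.exists_edge_notMem_right
      obtain ⟨C, hCs, hC, habC, hfC⟩ := hF.exists_circuit_side hp hdiag hab hAB hc hf hfB
      refine hclosed C (hCs.trans ?_) hC ⟨f, hfC, hf⟩ habC
      exact Set.insert_subset (hXE heX) fun e he => hFE he.1
  intro f hf
  induction e with | _ u w
  induction f with | _ x y
  obtain ⟨T, hT1, hT2, hT3⟩ := Finset.exists_subsuperset_card_eq
    (s := {u, w, x, y}) (t := X.toFinset) (n := 4) (by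
      intro z hz
      rw [Set.mem_toFinset]
      simp only [Finset.mem_insert, Finset.mem_singleton] at hz
      rcases hz with rfl | rfl | rfl | rfl
      · exact heX.2 _ (by simp)
      · exact heX.2 _ (by simp)
      · exact hf.2 _ (by simp)
      · exact hf.2 _ (by simp)) Finset.card_le_four
      (by rw [← Set.ncard_eq_toFinset_card']; exact hX.1)
  have hmem : ∀ z ∈ ({u, w, x, y} : Finset V), z ∈ (T : Set V) := fun z hz => hT1 hz
  refine hclosed (cliqueEdges (T : Set V)) (fun g hg => hXE ⟨hg.1, fun v hv => ?_⟩)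
    (hp.depCircuit_cliqueEdges hT3) ⟨s(u, w), ⟨heX.1, ?_⟩, heF⟩ ⟨hf.1, ?_⟩
  · simpa using hT2 (hg.2 v hv)
  · simpa using ⟨hmem u (by simp), hmem w (by simp)⟩
  · simpa using ⟨hmem x (by simp), hmem y (by simp)⟩

end Conn

section GenericPlacements

theorem exists_generic (V : Type*) [Finite V] (d : ℕ) : ∃ p : V → Fin d → ℝ, Generic p := by
  obtain ⟨s, hs⟩ := exists_isTranscendenceBasis ℚ ℝ
  have hinf : Infinite s := by
    by_contra hfin
    rw [not_infinite_iff_finite] at hfin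
    have h1 : Cardinal.mk ℝ ≤ max (Cardinal.mk (Algebra.adjoin ℚ (Set.range ((↑) : s → ℝ))))
        Cardinal.aleph0 := by
      have := hs.isAlgebraic
      exact Algebra.IsAlgebraic.cardinalMk_le_max _ _
    have h2 : Cardinal.mk (Algebra.adjoin ℚ (Set.range ((↑) : s → ℝ))) ≤ Cardinal.aleph0 := by
      rw [← Cardinal.mk_congr hs.1.aevalEquiv.toEquiv]
      refine (MvPolynomial.cardinalMk_le_max).trans (max_le (max_le ?_ ?_) le_rfl)
      · simp
      · exact Cardinal.mk_le_aleph0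
    have h3 : Cardinal.mk ℝ ≤ Cardinal.aleph0 := h1.trans (max_le h2 le_rfl)
    rw [Cardinal.mk_real] at h3
    exact absurd h3 (not_le.2 Cardinal.aleph0_lt_continuum)
  obtain ⟨f⟩ : Nonempty (V × Fin d ↪ s) := by
    cases nonempty_fintype V
    obtain ⟨t, ht⟩ := Infinite.exists_subset_card_eq s (Fintype.card (V × Fin d))
    have e : V × Fin d ≃ t := Fintype.equivOfCardEq (by rw [Fintype.card_coe, ht])
    exact ⟨e.toEmbedding.trans (Function.Embedding.subtype _)⟩
  exact ⟨fun v i => f (v, i), hs.1.comp f f.injective⟩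

variable {p : V → Fin 2 → ℝ}

theorem Generic.aeval_ne_zero (hp : Generic p) {P : MvPolynomial (V × Fin 2) ℚ}
    {q : V → Fin 2 → ℝ} (hq : MvPolynomial.aeval (fun vi : V × Fin 2 => q vi.1 vi.2) P ≠ 0) :
    MvPolynomial.aeval (fun vi : V × Fin 2 => p vi.1 vi.2) P ≠ 0 := by
  intro h0
  apply hq
  rw [AlgebraicIndependent.eq_zero_of_aeval_eq_zero hp P h0, map_zero]

theorem Generic.injective (hp : Generic p) : Function.Injective p := by
  intro u v huv
  have h : (fun vi : V × Fin 2 => p vi.1 vi.2) (u, 0) =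
      (fun vi : V × Fin 2 => p vi.1 vi.2) (v, 0) := by simp [huv]
  exact congrArg Prod.fst (AlgebraicIndependent.injective hp h)

theorem Generic.noncollinear (hp : Generic p) {a b c : V} (hab : a ≠ b) (hac : a ≠ c)
    (hbc : b ≠ c) :
    (p a 0 - p b 0) * (p a 1 - p c 1) - (p a 1 - p b 1) * (p a 0 - p c 0) ≠ 0 := by
  classical
  obtain ⟨P, hP⟩ : ∃ P : MvPolynomial (V × Fin 2) ℚ, ∀ q : V → Fin 2 → ℝ,
      MvPolynomial.aeval (fun vi : V × Fin 2 => q vi.1 vi.2) P =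
        (q a 0 - q b 0) * (q a 1 - q c 1) - (q a 1 - q b 1) * (q a 0 - q c 0) :=
    ⟨(MvPolynomial.X (a, 0) - MvPolynomial.X (b, 0)) *
        (MvPolynomial.X (a, 1) - MvPolynomial.X (c, 1)) -
      (MvPolynomial.X (a, 1) - MvPolynomial.X (b, 1)) *
        (MvPolynomial.X (a, 0) - MvPolynomial.X (c, 0)), fun q => by simp⟩
  obtain ⟨q, hq⟩ : ∃ q : V → Fin 2 → ℝ,
      (q a 0 - q b 0) * (q a 1 - q c 1) - (q a 1 - q b 1) * (q a 0 - q c 0) ≠ 0 :=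
    ⟨fun v => if v = b then ![1, 0] else if v = c then ![0, 1] else 0,
      by simp [hab, hac, hbc.symm]⟩
  rw [← hP] at hq ⊢
  exact hp.aeval_ne_zero hq

theorem linearIndependent_rows_iff_det_gram {m n : Type*} [Fintype m] [DecidableEq m] [Fintype n]
    (A : Matrix m n ℝ) : LinearIndependent ℝ A.row ↔ (A * A.transpose).det ≠ 0 := by
  have h1 : LinearIndependent ℝ A.row ↔ A.rank = Fintype.card m := by
    rw [linearIndependent_iff_card_eq_finrank_span, A.rank_eq_finrank_span_row, eq_comm,
      Set.finrank]
  rw [h1, ← Matrix.rank_self_mul_transpose, ← isUnit_iff_ne_zero, ← Matrix.isUnit_iff_isUnit_det,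
    ← Matrix.linearIndependent_rows_iff_isUnit, linearIndependent_iff_card_eq_finrank_span,
    (A * A.transpose).rank_eq_finrank_span_row, eq_comm, Set.finrank]

variable [DecidableEq V]

theorem exists_aeval_eq_row (e : Sym2 V) (j : V × Fin 2) :
    ∃ P : MvPolynomial (V × Fin 2) ℚ, ∀ q : V → Fin 2 → ℝ,
      MvPolynomial.aeval (fun vi : V × Fin 2 => q vi.1 vi.2) P = row q e j := by
  induction e with | _ u v
  refine ⟨if j.1 = u then MvPolynomial.X (u, j.2) - MvPolynomial.X (v, j.2)
    else if j.1 = v then MvPolynomial.X (v, j.2) - MvPolynomial.X (u, j.2) else 0, fun q => ?_⟩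
  rw [row_mk, edgeVec]
  split_ifs <;> simp

variable [Fintype V]

theorem Generic.linearIndepOn_row (hp : Generic p) {q : V → Fin 2 → ℝ} {T : Set (Sym2 V)}
    (hT : LinearIndepOn ℝ (row q) T) : LinearIndepOn ℝ (row p) T := by
  classical
  have := Fintype.ofFinite T
  choose P hP using exists_aeval_eq_row (V := V)
  let M : Matrix T (V × Fin 2) (MvPolynomial (V × Fin 2) ℚ) := Matrix.of fun e j => P e j
  have hM : ∀ r : V → Fin 2 → ℝ,
      MvPolynomial.aeval (fun vi : V × Fin 2 => r vi.1 vi.2) (M * M.transpose).det =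
        (Matrix.of (fun (e : T) j => row r e j) *
          (Matrix.of fun (e : T) j => row r e j).transpose).det := by
    intro r
    rw [AlgHom.map_det]
    congr 1
    ext e f
    simp [M, Matrix.mul_apply, hP]
  have key : ∀ r : V → Fin 2 → ℝ, LinearIndepOn ℝ (row r) T ↔
      MvPolynomial.aeval (fun vi : V × Fin 2 => r vi.1 vi.2) (M * M.transpose).det ≠ 0 := by
    intro r
    rw [hM, ← linearIndependent_rows_iff_det_gram]
    rfl
  rw [key] at hT ⊢
  exact hp.aeval_ne_zero hT

theorem Generic.goodPlacement (hp : Generic p) : GoodPlacement p where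
  injective := hp.injective
  noncollinear _ _ _ := hp.noncollinear
  rank_eq F := by
    have hle : ∀ q : V → Fin 2 → ℝ, rankAt 2 q F ≤ rankAt 2 p F := by
      intro q
      rw [rankAt_eq, rankAt_eq]
      obtain ⟨T, hTF, hT, hc⟩ := exists_linearIndepOn_ncard_eq (row q) F
      rw [← hc, ← (linearIndepOn_iff_finrank (row p) T).1 (hp.linearIndepOn_row hT)]
      exact Submodule.finrank_mono (Submodule.span_mono (Set.image_mono hTF))
    refine le_antisymm (le_csSup ⟨rankAt 2 p F, ?_⟩ ⟨p, rfl⟩) (csSup_le ⟨_, p, rfl⟩ ?_)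
    · rintro _ ⟨q, rfl⟩
      exact hle q
    · rintro _ ⟨q, rfl⟩
      exact hle q

end GenericPlacements

section Rotation

variable [DecidableEq V] [Fintype V] {p : V → Fin 2 → ℝ}

theorem GoodPlacement.exists_two_neighbors (hp : GoodPlacement p) {G : SimpleGraph V}
    (hG : RigidFramework G p) (hV : 3 ≤ Fintype.card V) (y : V) :
    ∃ a b, a ≠ b ∧ G.Adj y a ∧ G.Adj y b := by
  by_contra! hcon
  obtain ⟨z, hzy, hz⟩ : ∃ z, z ≠ y ∧ ∀ a, G.Adj y a → a = z := by
    by_cases hn : ∃ a, G.Adj y a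
    · obtain ⟨a, ha⟩ := hn
      refine ⟨a, ha.ne', fun b hb => ?_⟩
      by_contra hba
      exact hcon a b (Ne.symm hba) ha hb
    · push Not at hn
      obtain ⟨z, hz⟩ := Fintype.exists_ne_of_one_lt_card (by omega : 1 < Fintype.card V) y
      exact ⟨z, hz, fun a ha => absurd ha (hn a)⟩
  obtain ⟨w, hwy, hwz⟩ : ∃ w, w ≠ y ∧ w ≠ z := by
    obtain ⟨w, hw⟩ : ∃ w, w ∉ ({y, z} : Finset V) := by
      by_contra! h
      have h1 := Finset.card_le_card (fun a _ => h a : Finset.univ ⊆ ({y, z} : Finset V))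
      have h2 := Finset.card_le_two (a := y) (b := z)
      rw [Finset.card_univ] at h1
      omega
    exact ⟨w, by simp_all⟩
  obtain ⟨ε, hε, hrig⟩ := hG
  set u : Fin 2 → ℝ := fun i => p y i - p z i with hu
  set d : Fin 2 → ℝ := fun i => p z i - p w i with hd
  have hcross : u 0 * d 1 - u 1 * d 0 ≠ 0 := by
    have := hp.noncollinear y z w hzy.symm hwy.symm hwz.symm
    intro h0
    apply this
    simp only [hu, hd] at h0
    linear_combination h0
  obtain ⟨t, ht0, htε, htx⟩ : ∃ t : ℝ, 0 < t ∧ 4 * t ^ 2 * (u 0 ^ 2 + u 1 ^ 2) < ε ^ 2 ∧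
      u 0 * d 1 - u 1 * d 0 + t * (u 0 * d 0 + u 1 * d 1) ≠ 0 := by
    have h1 : ∀ᶠ t : ℝ in nhds 0, 4 * t ^ 2 * (u 0 ^ 2 + u 1 ^ 2) < ε ^ 2 := by
      have hc : Continuous fun t : ℝ => 4 * t ^ 2 * (u 0 ^ 2 + u 1 ^ 2) := by fun_prop
      exact hc.continuousAt.eventually_lt continuousAt_const (by simpa using pow_pos hε 2)
    have h2 : ∀ᶠ t : ℝ in nhds 0,
        u 0 * d 1 - u 1 * d 0 + t * (u 0 * d 0 + u 1 * d 1) ≠ 0 := by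
      have hc : Continuous fun t : ℝ =>
        u 0 * d 1 - u 1 * d 0 + t * (u 0 * d 0 + u 1 * d 1) := by fun_prop
      exact hc.continuousAt.eventually_ne (by simpa using hcross)
    have h3 := (h1.and h2).filter_mono (nhdsWithin_le_nhds (s := Set.Ioi (0 : ℝ)))
    obtain ⟨t, ⟨ht1, ht2⟩, ht3⟩ := (h3.and self_mem_nhdsWithin).exists
    exact ⟨t, ht3, ht1, ht2⟩
  have hpos : (0 : ℝ) < 1 + t ^ 2 := by positivity
  have hne := hpos.ne'
  set c := (1 - t ^ 2) / (1 + t ^ 2) with hc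
  set s := 2 * t / (1 + t ^ 2) with hs
  have hcs : c ^ 2 + s ^ 2 = 1 := by
    rw [hc, hs]
    field_simp
    ring
  let r : Fin 2 → ℝ := ![p z 0 + (c * u 0 + s * u 1), p z 1 + (c * u 1 - s * u 0)]
  let q : V → Fin 2 → ℝ := Function.update p y r
  have hqy : q y = r := Function.update_self ..
  have hqv : ∀ v, v ≠ y → q v = p v := fun v hv => Function.update_of_ne hv ..
  have hcomm : ∀ a b : Fin 2 → ℝ, eDist a b = eDist b a := by
    intro a b
    simp only [eDist]
    congr 1
    exact Finset.sum_congr rfl fun i _ => by ring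
  have hyz : eDist (p y) (p z) = eDist r (p z) := by
    simp only [eDist, Fin.sum_univ_two, r, Matrix.cons_val_zero, Matrix.cons_val_one]
    congr 1
    simp only [hu]
    linear_combination (-(p y 0 - p z 0) ^ 2 - (p y 1 - p z 1) ^ 2) * hcs
  have heq : Equivalent G p q := by
    intro a b hab
    by_cases ha : a = y
    · subst ha
      rw [hz b hab, hqy, hqv z hzy, hyz]
    · by_cases hb : b = y
      · subst hb
        rw [hz a hab.symm, hqy, hqv z hzy, hcomm, hyz, hcomm]
      · rw [hqv a ha, hqv b hb]
  have hcong := hrig q heq (by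
    intro v
    by_cases hv : v = y
    · subst hv
      rw [hqy]
      simp only [eDist, Fin.sum_univ_two, r, Matrix.cons_val_zero, Matrix.cons_val_one]
      rw [Real.sqrt_lt' hε]
      refine lt_of_le_of_lt ?_ htε
      have h1 : (p v 0 - (p z 0 + (c * u 0 + s * u 1))) ^ 2 +
          (p v 1 - (p z 1 + (c * u 1 - s * u 0))) ^ 2 =
          4 * t ^ 2 * (u 0 ^ 2 + u 1 ^ 2) / (1 + t ^ 2) := by
        have h2 : p v 0 - (p z 0 + (c * u 0 + s * u 1)) = u 0 - (c * u 0 + s * u 1) := by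
          simp only [hu]; ring
        have h3 : p v 1 - (p z 1 + (c * u 1 - s * u 0)) = u 1 - (c * u 1 - s * u 0) := by
          simp only [hu]; ring
        rw [h2, h3, hc, hs]
        field_simp
        ring
      rw [h1]
      exact div_le_self (by positivity) (by nlinarith)
    · rw [hqv v hv]
      simpa [eDist] using hε)
  have hyw := hcong y w
  rw [hqy, hqv w hwy] at hyw
  simp only [eDist, Fin.sum_univ_two, r, Matrix.cons_val_zero, Matrix.cons_val_one] at hyw
  rw [Real.sqrt_inj (by positivity) (by positivity)] at hyw
  have h2 : ∀ i, p y i - p w i = u i + d i := fun i => by simp only [hu, hd]; ring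
  have h3 : p z 0 + (c * u 0 + s * u 1) - p w 0 = c * u 0 + s * u 1 + d 0 := by
    simp only [hd]; ring
  have h4 : p z 1 + (c * u 1 - s * u 0) - p w 1 = c * u 1 - s * u 0 + d 1 := by
    simp only [hd]; ring
  rw [h2, h2, h3, h4] at hyw
  have h5 : (1 - c) * (u 0 * d 0 + u 1 * d 1) + s * (u 0 * d 1 - u 1 * d 0) = 0 := by
    linear_combination hyw / 2 + (u 0 ^ 2 + u 1 ^ 2) / 2 * hcs
  have h6 : 1 - c = s * t := by
    rw [hc, hs]
    field_simp
    ring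
  have hs0 : s ≠ 0 := by
    rw [hs]
    positivity
  apply htx
  apply mul_left_cancel₀ hs0
  rw [h6] at h5
  linear_combination h5

end Rotation

theorem sum_ncard_incidence {α β : Type*} [Fintype α] [Fintype β] (r : α → β → Prop)
    (P : β → Prop) [DecidablePred P] : ∑ a, {b | P b ∧ r a b}.ncard =
      ∑ b with P b, {a | r a b}.ncard := by
  classical
  have h := Finset.sum_card_bipartiteAbove_eq_sum_card_bipartiteBelow r
    (s := Finset.univ) (t := Finset.univ.filter P)
  convert h using 2 with a _ b _
  · rw [← Set.ncard_coe_finset]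
    congr 1
    ext b
    simp [Finset.bipartiteAbove]
  · rw [← Set.ncard_coe_finset]
    congr 1
    ext b
    simp [Finset.bipartiteBelow]

theorem cliqueEdges_nonempty [Finite V] {X : Set V} (h : 2 ≤ X.ncard) : (cliqueEdges X).Nonempty := by
  obtain ⟨a, b, ha, hb, hab⟩ := (Set.one_lt_ncard_iff (Set.toFinite X)).1 h
  refine ⟨s(a, b), by simpa using hab, fun v hv => ?_⟩
  rcases Sym2.mem_iff.1 hv with rfl | rfl <;> assumption

section Components

variable [DecidableEq V] {G : SimpleGraph V} {F : Set (Sym2 V)}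

theorem IsRdComponent.subset_edgeSet (hF : IsRdComponent 2 G F) : F ⊆ G.edgeSet := by
  obtain ⟨e, he, rfl⟩ := hF
  exact fun f hf => hf.1

theorem IsRdComponent.not_isDiag (hF : IsRdComponent 2 G F) : ∀ e ∈ F, ¬ e.IsDiag :=
  fun _ he => G.not_isDiag_of_mem_edgeSet (hF.subset_edgeSet he)

theorem exists_isRdComponent {e : Sym2 V} (he : e ∈ G.edgeSet) :
    ∃ F, IsRdComponent 2 G F ∧ e ∈ F :=
  ⟨_, ⟨e, he, rfl⟩, he, Or.inl rfl⟩

variable [Fintype V] {p : V → Fin 2 → ℝ}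

theorem GoodPlacement.circuit_subset_component (hp : GoodPlacement p) (hF : IsRdComponent 2 G F)
    {C : Set (Sym2 V)} (hCG : C ⊆ G.edgeSet) (hC : DepCircuit (row p) C)
    (h : (C ∩ F).Nonempty) : C ⊆ F := by
  obtain ⟨e, he, rfl⟩ := hF
  obtain ⟨f, hfC, hf, hef⟩ := h
  intro g hg
  refine ⟨hCG hg, ?_⟩
  rcases hef with rfl | ⟨D, ⟨hDG, hD⟩, heD, hfD⟩
  · exact Or.inr ⟨C, ⟨hCG, (hp.rdCircuit_iff C).2 hC⟩, hfC, hg⟩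
  · obtain ⟨K, hK, heK, hgK, hKs⟩ :=
      ((hp.rdCircuit_iff D).1 hD).exists_common hC ⟨f, hfD, hfC⟩ heD hg
    exact Or.inr ⟨K, ⟨hKs.trans (Set.union_subset hDG hCG), (hp.rdCircuit_iff K).2 hK⟩, heK, hgK⟩

theorem GoodPlacement.circuitConn_component (hp : GoodPlacement p) (hF : IsRdComponent 2 G F) :
    CircuitConn p F := by
  have hsub : ∀ {C f}, C ⊆ G.edgeSet → DepCircuit (row p) C → f ∈ C → f ∈ F → C ⊆ F :=
    fun hCG hC hfC hf => hp.circuit_subset_component hF hCG hC ⟨_, hfC, hf⟩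
  intro f hf g hg
  have hf' := hf
  have hg' := hg
  obtain ⟨e, he, rfl⟩ := hF
  obtain ⟨-, rfl | ⟨C, ⟨hCG, hC⟩, heC, hfC⟩⟩ := hf'
  · obtain ⟨-, rfl | ⟨D, ⟨hDG, hD⟩, heD, hgD⟩⟩ := hg'
    · exact Or.inl rfl
    · rw [hp.rdCircuit_iff] at hD
      exact Or.inr ⟨D, hsub hDG hD hgD hg, hD, heD, hgD⟩
  · rw [hp.rdCircuit_iff] at hC
    obtain ⟨-, rfl | ⟨D, ⟨hDG, hD⟩, heD, hgD⟩⟩ := hg'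
    · exact Or.inr ⟨C, hsub hCG hC hfC hf, hC, hfC, heC⟩
    · rw [hp.rdCircuit_iff] at hD
      obtain ⟨K, hK, hfK, hgK, hKs⟩ := hC.exists_common hD ⟨e, heC, heD⟩ hfC hgD
      exact Or.inr ⟨K, hsub (hKs.trans (Set.union_subset hCG hDG)) hK hfK hf, hK, hfK, hgK⟩

theorem GoodPlacement.component_eq (hp : GoodPlacement p) {F' : Set (Sym2 V)}
    (hF : IsRdComponent 2 G F) (hF' : IsRdComponent 2 G F') {e : Sym2 V} (he : e ∈ F)
    (he' : e ∈ F') : F = F' := by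
  have key : ∀ {F F' : Set (Sym2 V)}, IsRdComponent 2 G F → IsRdComponent 2 G F' →
      e ∈ F → e ∈ F' → F ⊆ F' := by
    intro F F' hF hF' he he' g hg
    rcases hp.circuitConn_component hF e he g hg with rfl | ⟨C, hCF, hC, heC, hgC⟩
    · exact he'
    · exact hp.circuit_subset_component hF' (hCF.trans hF.subset_edgeSet) hC ⟨e, heC, he'⟩ hgC
  exact (key hF hF' he he').antisymm (key hF' hF he' he)

theorem GoodPlacement.four_le_ncard_component (hp : GoodPlacement p) (hF : IsRdComponent 2 G F)
    (h2 : 2 ≤ F.ncard) : 4 ≤ (vertexSpan F).ncard := by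
  obtain ⟨e, he⟩ := Set.nonempty_of_ncard_ne_zero (by omega : F.ncard ≠ 0)
  obtain ⟨C, hCF, hC, -⟩ := (hp.circuitConn_component hF).exists_circuit_mem h2 he
  exact hp.four_le_ncard_vertexSpan hF.not_isDiag hC hCF

theorem GoodPlacement.isRdBlockVerts_iff (hp : GoodPlacement p) {X : Set V} :
    IsRdBlockVerts 2 G X ↔ ∃ F, (IsRdComponent 2 G F ∧ 2 ≤ F.ncard) ∧ X ∈ threeBlocks F := by
  refine exists_congr fun F => ?_
  rw [and_assoc]
  refine and_congr_right fun hF => and_congr_right fun h2 => exists_isThreeBlock_iff ?_ X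
  exact (by norm_num : 3 ≤ 4).trans (hp.four_le_ncard_component hF h2)

theorem GoodPlacement.notMem_component_of_bridge (hp : GoodPlacement p)
    (hF : IsRdComponent 2 G F) (h2 : 2 ≤ F.ncard) {e : Sym2 V} (hb : IsRdBridge 2 G e) :
    e ∉ F := by
  intro he
  obtain ⟨C, hCF, hC, heC⟩ := (hp.circuitConn_component hF).exists_circuit_mem h2 he
  exact hp.notMem_circuit_of_bridge hb (hCF.trans hF.subset_edgeSet) hC heC

theorem GoodPlacement.exists_block_of_not_bridge (hp : GoodPlacement p) {e : Sym2 V}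
    (he : e ∈ G.edgeSet) (hb : ¬ IsRdBridge 2 G e) {y : V} (hy : y ∈ e) :
    ∃ X, IsRdBlockVerts 2 G X ∧ y ∈ X := by
  obtain ⟨C, hCG, hC, heC⟩ := hp.exists_circuit_of_not_bridge he hb
  obtain ⟨F, hF, heF⟩ := exists_isRdComponent he
  have hCF := hp.circuit_subset_component hF hCG hC ⟨e, heC, heF⟩
  have h2 : 2 ≤ F.ncard := by
    by_contra! h
    have h1 : F = {e} := by
      have h0 : F.ncard = 1 := by
        have := (Set.ncard_pos (Set.toFinite F)).2 ⟨e, heF⟩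
        omega
      obtain ⟨f, rfl⟩ := Set.ncard_eq_one.1 h0
      rw [Set.mem_singleton_iff.1 heF]
    subst h1
    have hCe : C = {e} := hCF.antisymm (Set.singleton_subset_iff.2 heC)
    subst hCe
    exact hC.1 ((linearIndepOn_singleton_iff ℝ).2
      (hp.row_ne_zero (G.not_isDiag_of_mem_edgeSet he)))
  obtain ⟨Y, hYF, hY, hyY⟩ :=
    (hp.circuitConn_component hF).exists_three hp hF.not_isDiag h2 (y := y) ⟨e, heF, hy⟩
  obtain ⟨X, hX, hYX⟩ := hY.exists_threeBlock hYF
  exact ⟨X, hp.isRdBlockVerts_iff.2 ⟨F, ⟨hF, h2⟩, hX⟩, hYX hyY⟩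

theorem GoodPlacement.cliqueEdges_block_subset (hp : GoodPlacement p)
    (hcomplete : ∀ X : Set V, IsRdBlockVerts 2 G X → ∀ a ∈ X, ∀ b ∈ X, a ≠ b → G.Adj a b)
    (hF : IsRdComponent 2 G F) (h2 : 2 ≤ F.ncard) {X : Set V} (hX : X ∈ threeBlocks F) : cliqueEdges X ⊆ F := by
  refine (hp.circuitConn_component hF).cliqueEdges_subset hp hF.not_isDiag hF.subset_edgeSet
    (fun C hCG hC h => hp.circuit_subset_component hF hCG hC h) hX.2.1 ?_
  rintro e ⟨hd, he⟩
  induction e with | _ a b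
  exact hcomplete X (hp.isRdBlockVerts_iff.2 ⟨F, ⟨hF, h2⟩, hX⟩) a (he a (by simp)) b
    (he b (by simp)) (by simpa using hd)

end Components

section Counting

variable [DecidableEq V] [Fintype V] {p : V → Fin 2 → ℝ} {G : SimpleGraph V}

theorem GoodPlacement.exists_indep_subset_component (hp : GoodPlacement p)
    (hcomplete : ∀ X : Set V, IsRdBlockVerts 2 G X → ∀ a ∈ X, ∀ b ∈ X, a ≠ b → G.Adj a b)
    {F : Set (Sym2 V)} (hF : IsRdComponent 2 G F) (h2 : 2 ≤ F.ncard) (𝒳 : Finset (Set V))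
    (h𝒳 : ∀ X ∈ 𝒳, X ∈ threeBlocks F) :
    ∃ T ⊆ F, LinearIndepOn ℝ (row p) T ∧ ∑ X ∈ 𝒳, X.ncard ≤ T.ncard := by
  rcases 𝒳.eq_empty_or_nonempty with rfl | hne
  · exact ⟨∅, Set.empty_subset _, linearIndepOn_empty _ _, by simp⟩
  have h := hp.sum_ncard_add_one_le (vertexSpan F) 𝒳 hne (fun X hX => (h𝒳 X hX).1)
    (fun X hX => (h𝒳 X hX).2.1) (fun X hX => (h𝒳 X hX).2.2)
  obtain ⟨T, hTs, hT, hc⟩ := exists_linearIndepOn_ncard_eq (row p)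
    {e | ∃ X ∈ 𝒳, e ∈ cliqueEdges X}
  refine ⟨T, fun e he => ?_, hT, by omega⟩
  obtain ⟨X, hX, heX⟩ := hTs he
  exact hp.cliqueEdges_block_subset hcomplete hF h2 (h𝒳 X hX) heX

open Classical in
theorem GoodPlacement.sum_blocks_add_bridges_le (hp : GoodPlacement p)
    (hcomplete : ∀ X : Set V, IsRdBlockVerts 2 G X → ∀ a ∈ X, ∀ b ∈ X, a ≠ b → G.Adj a b)
    (hV : 2 ≤ Fintype.card V) :
    ∑ X with IsRdBlockVerts 2 G X, X.ncard + {e | IsRdBridge 2 G e}.ncard + 3 ≤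
      2 * Fintype.card V := by
  let 𝓕 : Finset (Set (Sym2 V)) :=
    Finset.univ.filter fun F => IsRdComponent 2 G F ∧ 2 ≤ F.ncard
  have h𝓕 : ∀ {F}, F ∈ 𝓕 ↔ IsRdComponent 2 G F ∧ 2 ≤ F.ncard := by simp [𝓕]
  let 𝓑 : Set (Sym2 V) → Finset (Set V) := fun F => Finset.univ.filter (· ∈ threeBlocks F)
  have h𝓑 : ∀ {F X}, X ∈ 𝓑 F ↔ X ∈ threeBlocks F := by simp [𝓑]
  have hsub : ∀ {F}, F ∈ 𝓕 → ∀ {X}, X ∈ 𝓑 F → cliqueEdges X ⊆ F := fun hF _ hX =>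
    hp.cliqueEdges_block_subset hcomplete (h𝓕.1 hF).1 (h𝓕.1 hF).2 (h𝓑.1 hX)
  have heq : ∀ {F}, F ∈ 𝓕 → ∀ {F'}, F' ∈ 𝓕 → ∀ {e}, e ∈ F → e ∈ F' → F = F' :=
    fun hF _ hF' _ he he' => hp.component_eq (h𝓕.1 hF).1 (h𝓕.1 hF').1 he he'
  have hblocks : Finset.univ.filter (IsRdBlockVerts 2 G) = 𝓕.biUnion 𝓑 := by
    ext X
    simp [hp.isRdBlockVerts_iff, h𝓕, h𝓑]
  have hsum : ∑ X with IsRdBlockVerts 2 G X, X.ncard = ∑ F ∈ 𝓕, ∑ X ∈ 𝓑 F, X.ncard := by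
    rw [hblocks, Finset.sum_biUnion]
    intro F hF F' hF' hne
    refine Finset.disjoint_left.2 fun X hX hX' => hne ?_
    obtain ⟨e, he⟩ := cliqueEdges_nonempty
      ((by norm_num : 2 ≤ 4).trans (h𝓑.1 hX).2.1.1)
    exact heq hF hF' (hsub hF hX he) (hsub hF' hX' he)
  have hex : ∀ F, ∃ T : Finset (Sym2 V), F ∈ 𝓕 → (∀ e ∈ T, e ∈ F) ∧
      LinearIndepOn ℝ (row p) (T : Set (Sym2 V)) ∧ ∑ X ∈ 𝓑 F, X.ncard ≤ T.card := by
    intro F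
    by_cases hF : F ∈ 𝓕
    · obtain ⟨T, hTF, hT, hc⟩ := hp.exists_indep_subset_component hcomplete (h𝓕.1 hF).1
        (h𝓕.1 hF).2 (𝓑 F) (fun X hX => h𝓑.1 hX)
      refine ⟨T.toFinset, fun _ => ⟨fun e he => hTF (Set.mem_toFinset.1 he), ?_, ?_⟩⟩
      · rwa [Set.coe_toFinset]
      · rwa [← Set.ncard_eq_toFinset_card']
    · exact ⟨∅, fun h => absurd h hF⟩
  choose T hT using hex
  let B : Finset (Sym2 V) := Finset.univ.filter fun e => IsRdBridge 2 G e
  have hB : ∀ {e}, e ∈ B ↔ IsRdBridge 2 G e := by simp [B]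
  have hBc : {e | IsRdBridge 2 G e}.ncard = B.card := by
    rw [← Set.ncard_coe_finset]
    simp [B]
  have hdisj : Disjoint (𝓕.biUnion T) B := by
    refine Finset.disjoint_left.2 fun e he heB => ?_
    obtain ⟨F, hF, heF⟩ := Finset.mem_biUnion.1 he
    exact hp.notMem_component_of_bridge (h𝓕.1 hF).1 (h𝓕.1 hF).2 (hB.1 heB)
      ((hT F hF).1 e heF)
  have hUE : ∀ e ∈ 𝓕.biUnion T ∪ B, e ∈ G.edgeSet := by
    intro e he
    rcases Finset.mem_union.1 he with he | he
    · obtain ⟨F, hF, heF⟩ := Finset.mem_biUnion.1 he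
      exact (h𝓕.1 hF).1.subset_edgeSet ((hT F hF).1 e heF)
    · exact (hB.1 he).1
  have hind : LinearIndepOn ℝ (row p) (↑(𝓕.biUnion T ∪ B) : Set (Sym2 V)) := by
    by_contra hdep
    obtain ⟨C, hC, hCs, e, heC⟩ := exists_depCircuit_subset hdep
    have hCE : C ⊆ G.edgeSet := fun f hf => hUE f (hCs hf)
    have hCT : ∀ f ∈ C, ∃ F ∈ 𝓕, f ∈ T F := by
      intro f hf
      rcases Finset.mem_union.1 (hCs hf) with h | h
      · exact Finset.mem_biUnion.1 h
      · exact absurd hf (hp.notMem_circuit_of_bridge (hB.1 h) hCE hC)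
    obtain ⟨F, hF, heF⟩ := hCT e heC
    have hCF := hp.circuit_subset_component (h𝓕.1 hF).1 hCE hC ⟨e, heC, (hT F hF).1 e heF⟩
    refine hC.1 ((hT F hF).2.1.mono fun f hf => ?_)
    obtain ⟨F', hF', hfF'⟩ := hCT f hf
    rwa [heq hF hF' (hCF hf) ((hT F' hF').1 f hfF')]
  have hcard : (𝓕.biUnion T ∪ B).card = ∑ F ∈ 𝓕, (T F).card + B.card := by
    rw [Finset.card_union_of_disjoint hdisj, Finset.card_biUnion]
    intro F hF F' hF' hne
    exact Finset.disjoint_left.2 fun e he he' =>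
      hne (heq hF hF' ((hT F hF).1 e he) ((hT F' hF').1 e he'))
  have hle : ∑ F ∈ 𝓕, ∑ X ∈ 𝓑 F, X.ncard ≤ ∑ F ∈ 𝓕, (T F).card :=
    Finset.sum_le_sum fun F hF => (hT F hF).2.2
  have hrank := (linearIndepOn_iff_finrank _ _).1 hind
  rw [Set.ncard_coe_finset] at hrank
  have hspan := Submodule.finrank_mono (span_le_equil p (S := Set.univ)
    (F := (↑(𝓕.biUnion T ∪ B) : Set (Sym2 V))) fun _ _ _ _ => Set.mem_univ _)
  have huniv := finrank_equil_add_three_le_ncard hp.injective (S := Set.univ)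
    (by rwa [Set.ncard_univ, Nat.card_eq_fintype_card])
  rw [Set.ncard_univ, Nat.card_eq_fintype_card] at huniv
  omega

theorem GoodPlacement.two_le_blocks_bridges (hp : GoodPlacement p) {y : V}
    (hy : ∃ a b, a ≠ b ∧ G.Adj y a ∧ G.Adj y b) :
    2 ≤ 2 * {X : Set V | IsRdBlockVerts 2 G X ∧ y ∈ X}.ncard +
      {e : Sym2 V | IsRdBridge 2 G e ∧ y ∈ e}.ncard := by
  by_cases h : ∃ X, IsRdBlockVerts 2 G X ∧ y ∈ X
  · have := (Set.ncard_pos (Set.toFinite {X : Set V | IsRdBlockVerts 2 G X ∧ y ∈ X})).2 h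
    omega
  · obtain ⟨a, b, hab, ha, hb⟩ := hy
    have hbr : ∀ {c}, G.Adj y c → s(y, c) ∈ {e : Sym2 V | IsRdBridge 2 G e ∧ y ∈ e} := by
      intro c hc
      refine ⟨?_, by simp⟩
      by_contra hn
      exact h (hp.exists_block_of_not_bridge (e := s(y, c)) hc hn (by simp))
    have : 1 < {e : Sym2 V | IsRdBridge 2 G e ∧ y ∈ e}.ncard := by
      rw [Set.one_lt_ncard_iff (Set.toFinite _)]
      refine ⟨_, _, hbr ha, hbr hb, fun h => hab ?_⟩
      exact (Sym2.congr_right.1 h)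
    omega

theorem four_le_of_not_reducible {y : V} (hy : ¬ Reducible G y)
    (h2 : 2 ≤ 2 * {X : Set V | IsRdBlockVerts 2 G X ∧ y ∈ X}.ncard +
      {e : Sym2 V | IsRdBridge 2 G e ∧ y ∈ e}.ncard) :
    4 ≤ 2 * {X : Set V | IsRdBlockVerts 2 G X ∧ y ∈ X}.ncard +
      {e : Sym2 V | IsRdBridge 2 G e ∧ y ∈ e}.ncard := by
  rw [Reducible, ← Set.ncard_eq_zero (Set.toFinite _)] at hy
  omega

end Counting

/-- A 2-rigid graph on at least four vertices in which every `ℛ₂`-block induces a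
complete subgraph has at least three reducible vertices. -/
theorem three_reducible_vertices {V : Type*} [Fintype V] [DecidableEq V]
    (G : SimpleGraph V) (hG : IsRigidGraph 2 G) (hV : 4 ≤ Fintype.card V)
    (hcomplete : ∀ X : Set V, IsRdBlockVerts 2 G X →
      ∀ a ∈ X, ∀ b ∈ X, a ≠ b → G.Adj a b) :
    3 ≤ {y : V | Reducible G y}.ncard := by
  classical
  obtain ⟨p, hgen⟩ := exists_generic V 2
  have hp := hgen.goodPlacement
  have hrig := hG p hgen
  set w : V → ℕ := fun y => 2 * {X : Set V | IsRdBlockVerts 2 G X ∧ y ∈ X}.ncard +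
    {e : Sym2 V | IsRdBridge 2 G e ∧ y ∈ e}.ncard with hw
  have h2 : ∀ y, 2 ≤ w y := fun y =>
    hp.two_le_blocks_bridges (hp.exists_two_neighbors hrig (by omega) y)
  have hlow : ∀ y, 4 ≤ w y + if Reducible G y then 2 else 0 := by
    intro y
    have := h2 y
    split_ifs with h
    · omega
    · exact four_le_of_not_reducible h (h2 y)
  have hbr : ∑ y, {e : Sym2 V | IsRdBridge 2 G e ∧ y ∈ e}.ncard =
      2 * {e | IsRdBridge 2 G e}.ncard := by
    rw [sum_ncard_incidence (fun (y : V) (e : Sym2 V) => y ∈ e), Finset.sum_const_nat (m := 2),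
      mul_comm, ← Set.ncard_coe_finset]
    · simp
    · intro e he
      rw [Finset.mem_filter_univ] at he
      rw [← Sym2.card_toFinset_of_not_isDiag e (G.not_isDiag_of_mem_edgeSet he.1),
        ← Set.ncard_coe_finset]
      congr 1
      ext v
      simp
  have hsum : ∑ y, w y = 2 * ∑ X with IsRdBlockVerts 2 G X, X.ncard +
      2 * {e | IsRdBridge 2 G e}.ncard := by
    rw [hw, Finset.sum_add_distrib, ← Finset.mul_sum, hbr,
      sum_ncard_incidence (fun (y : V) (X : Set V) => y ∈ X)]
    rfl
  have hle := hp.sum_blocks_add_bridges_le hcomplete (by omega)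
  have htot := Finset.sum_le_sum fun y (_ : y ∈ Finset.univ) => hlow y
  rw [Finset.sum_add_distrib, hsum, ← Finset.sum_filter, Finset.sum_const, Finset.sum_const,
    Finset.card_univ, smul_eq_mul, smul_eq_mul] at htot
  have hred : {y : V | Reducible G y}.ncard = (Finset.univ.filter fun y => Reducible G y).card := by
    rw [← Set.ncard_coe_finset]
    simp
  omega

end Rigidity
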